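/- arXiv:2312.17497 — 3 statements merged into one kernel-verified Lean document; each statement's English description precedes it below -/
import Mathlib

section
/- Let 0 ≤ q ≤ 1/2. Then for every c₀ ∈ Imm(S¹,ℝ^d) and every smooth orientation-preserving diffeomorphism φ₁ of S¹ the geodesic distance of the reparametrization-invariant Sobolev metric of order q satisfies dist_{G^q}(c₀, c₀∘φ₁) = 0. In particular there exist distinct curves c₀ ≠ c₁ in Imm(S¹,ℝ^d) with dist_{G^q}(c₀,c₁) = 0, i.e. the geodesic distance is degenerate. -/
open MeasureTheory intervalIntegral
open scoped BigOperators ENNReal RealInnerProductSpace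

noncomputable section

/-- Euclidean space `ℝ^d`. -/
abbrev Edim (d : ℕ) := EuclideanSpace ℝ (Fin d)

/-- `n`-th Fourier coefficient of a (1-periodic) function `f : ℝ → ℝ`,
identifying `S¹ = ℝ/ℤ`. -/
def fCoeff (f : ℝ → ℝ) (n : ℤ) : ℂ :=
  ∫ θ in (0:ℝ)..1,
    Complex.exp (-2 * (Real.pi : ℂ) * Complex.I * (n : ℂ) * (θ : ℂ)) * (f θ : ℂ)

/-- Squared norm `|f̂(n)|²` of the `n`-th Fourier coefficient of `f : S¹ → ℝ^d`. -/
def coeffNormSq {d : ℕ} (f : ℝ → Edim d) (n : ℤ) : ℝ :=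
  ∑ i : Fin d, ‖fCoeff (fun θ => f θ i) n‖ ^ 2

/-- Homogeneous Sobolev seminorm squared `‖f‖²_{Ḣ^q} = Σ |n|^{2q} |f̂(n)|²`. -/
def homSobSq {d : ℕ} (q : ℝ) (f : ℝ → Edim d) : ℝ :=
  ∑' n : ℤ, |(n : ℝ)| ^ (2 * q) * coeffNormSq f n

/-- Homogeneous Sobolev seminorm `‖f‖_{Ḣ^q}`. -/
def homSobNorm {d : ℕ} (q : ℝ) (f : ℝ → Edim d) : ℝ := Real.sqrt (homSobSq q f)

/-- Full Sobolev norm squared `‖f‖²_{H^q} = Σ (1+n²)^q |f̂(n)|²`. -/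
def sobSq {d : ℕ} (q : ℝ) (f : ℝ → Edim d) : ℝ :=
  ∑' n : ℤ, (1 + (n : ℝ) ^ 2) ^ q * coeffNormSq f n

/-- Full Sobolev norm `‖f‖_{H^q}`. -/
def sobNorm {d : ℕ} (q : ℝ) (f : ℝ → Edim d) : ℝ := Real.sqrt (sobSq q f)

/-- Membership in the Sobolev space `H^q(S¹, ℝ^d)`, viewed as 1-periodic
functions on `ℝ`: periodic, integrable on a period and with finite `H^q`-norm. -/
def InH {d : ℕ} (q : ℝ) (f : ℝ → Edim d) : Prop :=
  Function.Periodic f 1 ∧ IntegrableOn f (Set.Ioc (0:ℝ) 1) ∧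
    Summable (fun n : ℤ => (1 + (n : ℝ) ^ 2) ^ q * coeffNormSq f n)

/-- A tangent vector along a curve of class `H^r`, `r > 3/2`: a continuous
1-periodic function of class `H^r` (with values in the vector space `ℝ^d`). -/
def TangentH {d : ℕ} (r : ℝ) (h : ℝ → Edim d) : Prop :=
  Continuous h ∧ InH r h

/-- Scalar version: homogeneous Sobolev seminorm squared of `f : S¹ → ℝ`. -/
def homSobSq₁ (q : ℝ) (f : ℝ → ℝ) : ℝ :=
  ∑' n : ℤ, |(n : ℝ)| ^ (2 * q) * ‖fCoeff f n‖ ^ 2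

/-- Scalar version: full Sobolev norm squared of `f : S¹ → ℝ`. -/
def sobSq₁ (q : ℝ) (f : ℝ → ℝ) : ℝ :=
  ∑' n : ℤ, (1 + (n : ℝ) ^ 2) ^ q * ‖fCoeff f n‖ ^ 2

/-- Scalar version: membership in `H^q(S¹, ℝ)`. -/
def InH₁ (q : ℝ) (f : ℝ → ℝ) : Prop :=
  Function.Periodic f 1 ∧ IntegrableOn f (Set.Ioc (0:ℝ) 1) ∧
    Summable (fun n : ℤ => (1 + (n : ℝ) ^ 2) ^ q * ‖fCoeff f n‖ ^ 2)

/-- The length `l_c = ∫_{S¹} |c_θ| dθ` of a curve. -/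
def curveLen {d : ℕ} (c : ℝ → Edim d) : ℝ := ∫ θ in (0:ℝ)..1, ‖deriv c θ‖

/-- The constant-speed reparametrization `ψ_c(θ) = l_c⁻¹ ∫_0^θ |c_θ(σ)| dσ`. -/
def psi {d : ℕ} (c : ℝ → Edim d) (θ : ℝ) : ℝ :=
  (curveLen c)⁻¹ * ∫ σ in (0:ℝ)..θ, ‖deriv c σ‖

/-- The inverse `ψ_c⁻¹` of the constant-speed reparametrization. -/
def psiInv {d : ℕ} (c : ℝ → Edim d) : ℝ → ℝ := Function.invFun (psi c)

/-- Squared `L²(S¹)`-norm. -/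
def L2Sq {d : ℕ} (f : ℝ → Edim d) : ℝ := ∫ θ in (0:ℝ)..1, ‖f θ‖ ^ 2

/-- `‖h‖²_{G⁰_c} = l_c ‖h ∘ ψ_c⁻¹‖²_{L²}`. -/
def G0Sq {d : ℕ} (c h : ℝ → Edim d) : ℝ := curveLen c * L2Sq (h ∘ psiInv c)

/-- Homogeneous part `‖h‖²_{Ġ^q_c} = l_c^{1-2q} ‖h ∘ ψ_c⁻¹‖²_{Ḣ^q}`. -/
def GdotSq {d : ℕ} (q : ℝ) (c h : ℝ → Edim d) : ℝ :=
  curveLen c ^ (1 - 2 * q) * homSobSq q (h ∘ psiInv c)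

/-- Homogeneous seminorm `‖h‖_{Ġ^q_c}`. -/
def GdotNorm {d : ℕ} (q : ℝ) (c h : ℝ → Edim d) : ℝ := Real.sqrt (GdotSq q c h)

/-- The reparametrization-invariant Sobolev metric of order `q`:
`‖h‖²_{G^q_c} = l_c ‖h∘ψ_c⁻¹‖²_{L²} + l_c^{1-2q} ‖h∘ψ_c⁻¹‖²_{Ḣ^q}`. -/
def GSq {d : ℕ} (q : ℝ) (c h : ℝ → Edim d) : ℝ := G0Sq c h + GdotSq q c h

/-- The norm `‖h‖_{G^q_c}`. -/
def Gnorm {d : ℕ} (q : ℝ) (c h : ℝ → Edim d) : ℝ := Real.sqrt (GSq q c h)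

/-- The space `Imm(S¹,ℝ^d)` of smooth immersed closed curves. -/
def Imm (d : ℕ) : Set (ℝ → Edim d) :=
  {c | Function.Periodic c 1 ∧ ContDiff ℝ (⊤ : ℕ∞) c ∧ ∀ θ, deriv c θ ≠ 0}

/-- The space `I^r(S¹,ℝ^d)` of Sobolev immersions of class `H^r` (`r > 3/2`). -/
def SobImm (d : ℕ) (r : ℝ) : Set (ℝ → Edim d) :=
  {c | Function.Periodic c 1 ∧ Continuous c ∧
    Summable (fun n : ℤ => (1 + (n : ℝ) ^ 2) ^ r * coeffNormSq c n) ∧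
    ∀ θ, deriv c θ ≠ 0}

/-- Time derivative `∂_t c(t)` of a path of curves. -/
def pathVel {d : ℕ} (p : ℝ → ℝ → Edim d) (t : ℝ) : ℝ → Edim d :=
  fun θ => deriv (fun s => p s θ) t

/-- `G^q`-length of a path of curves over the time interval `[a,b]`. -/
def pathLenOn {d : ℕ} (q : ℝ) (p : ℝ → ℝ → Edim d) (a b : ℝ) : ℝ :=
  ∫ t in a..b, Gnorm q (p t) (pathVel p t)

/-- `G^q`-length of a path of curves over `[0,1]`. -/
def pathLen {d : ℕ} (q : ℝ) (p : ℝ → ℝ → Edim d) : ℝ := pathLenOn q p 0 1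

/-- Admissible (`C¹` in time) paths in `S` joining `c₀` to `c₁`. -/
def IsPathIn {d : ℕ} (S : Set (ℝ → Edim d)) (c₀ c₁ : ℝ → Edim d)
    (p : ℝ → ℝ → Edim d) : Prop :=
  p 0 = c₀ ∧ p 1 = c₁ ∧ (∀ t ∈ Set.Icc (0:ℝ) 1, p t ∈ S) ∧
    ∀ θ : ℝ, ContDiffOn ℝ 1 (fun t => p t θ) (Set.Icc (0:ℝ) 1)

/-- Geodesic distance of the metric `G^q` on the space `S` of curves:
the infimum of the `G^q`-lengths of admissible paths joining `c₀` to `c₁`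
(`∞` if there is no such path). -/
def geodDist {d : ℕ} (q : ℝ) (S : Set (ℝ → Edim d)) (c₀ c₁ : ℝ → Edim d) : ℝ≥0∞ :=
  ⨅ (p : ℝ → ℝ → Edim d) (_ : IsPathIn S c₀ c₁ p), ENNReal.ofReal (pathLen q p)

/-- The metric ball of radius `ρ` around `c₀` for the geodesic distance of `G^r`
on `I^r(S¹,ℝ^d)`. -/
def GBall {d : ℕ} (r : ℝ) (c₀ : ℝ → Edim d) (ρ : ℝ) : Set (ℝ → Edim d) :=
  {c | c ∈ SobImm d r ∧ geodDist r (SobImm d r) c₀ c < ENNReal.ofReal ρ}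

/-- A geodesic of `(S, G^q)` on the time interval `I`: a constant-speed path in
`S` that is locally length-minimizing. -/
def IsGeodesicOn {d : ℕ} (q : ℝ) (S : Set (ℝ → Edim d)) (p : ℝ → ℝ → Edim d)
    (I : Set ℝ) : Prop :=
  (∀ t ∈ I, p t ∈ S) ∧
  (∀ θ : ℝ, ContDiffOn ℝ 1 (fun t => p t θ) I) ∧
  (∃ v : ℝ, ∀ t ∈ I, Gnorm q (p t) (pathVel p t) = v) ∧
  ∀ t ∈ I, ∃ ε > 0, ∀ a ∈ I, ∀ b ∈ I, t - ε ≤ a → a ≤ b → b ≤ t + ε →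
    ENNReal.ofReal (pathLenOn q p a b) = geodDist q S (p a) (p b)


/-- A smooth orientation-preserving diffeomorphism of `S¹ = ℝ/ℤ`, viewed as a
smooth map `φ : ℝ → ℝ` with `φ(θ+1) = φ(θ)+1` and `φ' > 0`. -/
def IsCircleDiffeo (φ : ℝ → ℝ) : Prop :=
  ContDiff ℝ (⊤ : ℕ∞) φ ∧ (∀ θ, φ (θ + 1) = φ θ + 1) ∧ ∀ θ, 0 < deriv φ θ

/-! ### Fourier analysis -/

lemma fCoeff_eq_fourierCoeffOn (f : ℝ → ℝ) (n : ℤ) :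
    fCoeff f n = fourierCoeffOn (zero_lt_one (α := ℝ)) (fun x => (f x : ℂ)) n := by
  rw [fourierCoeffOn_eq_integral, fCoeff]
  simp only [sub_zero, div_one, one_smul]
  congr 1
  ext x
  rw [fourier_coe_apply, smul_eq_mul]
  congr 2
  push_cast
  simp

lemma bessel_fCoeff (f : ℝ → ℝ) (hf : Continuous f) (S : Finset ℤ) :
    ∑ n ∈ S, ‖fCoeff f n‖ ^ 2 ≤ ∫ x in (0:ℝ)..1, f x ^ 2 := by
  have hL2 : MemLp (fun x => (f x : ℂ)) 2 (volume.restrict (Set.Ioc (0:ℝ) 1)) := by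
    have hc : Continuous (fun x => (f x : ℂ)) := by fun_prop
    rw [memLp_two_iff_integrable_sq_norm hc.aestronglyMeasurable]
    have hc2 : Continuous (fun x => ‖(f x : ℂ)‖ ^ 2) := by fun_prop
    exact (hc2.integrableOn_Icc (a := 0) (b := 1)).mono_set Set.Ioc_subset_Icc_self
  have h := hasSum_sq_fourierCoeffOn (zero_lt_one (α := ℝ)) hL2
  simp only [sub_zero, inv_one, one_smul, Complex.norm_real, Real.norm_eq_abs, sq_abs,
    ← fCoeff_eq_fourierCoeffOn] at h
  exact sum_le_hasSum S (fun _ _ => by positivity) h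

lemma fCoeff_deriv_norm (f : ℝ → ℝ) (hf : ContDiff ℝ 1 f) (hp : Function.Periodic f 1) (n : ℤ) :
    |(n : ℝ)| * ‖fCoeff f n‖ ≤ ‖fCoeff (deriv f) n‖ := by
  rcases eq_or_ne n 0 with rfl | hn
  · simp
  have hd : ∀ x, HasDerivAt (fun x => (f x : ℂ)) ((deriv f x : ℝ) : ℂ) x := fun x =>
    ((hf.differentiable one_ne_zero) x).hasDerivAt.ofReal_comp
  have hc : Continuous (fun x => ((deriv f x : ℝ) : ℂ)) :=
    Complex.continuous_ofReal.comp (hf.continuous_deriv le_rfl)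
  have h := fourierCoeffOn_of_hasDerivAt (zero_lt_one (α := ℝ)) hn (fun x _ => hd x)
    (hc.intervalIntegrable _ _)
  have h1 : f 1 = f 0 := by simpa using hp 0
  rw [← fCoeff_eq_fourierCoeffOn, ← fCoeff_eq_fourierCoeffOn, h1] at h
  have h2 : ‖fCoeff f n‖ = 1 / (2 * Real.pi * |(n : ℝ)|) * ‖fCoeff (deriv f) n‖ := by
    rw [h]
    simp [Real.pi_pos.le]
  have hn' : 0 < |(n : ℝ)| := by positivity
  rw [h2]
  have : |(n : ℝ)| * (1 / (2 * Real.pi * |(n : ℝ)|) * ‖fCoeff (deriv f) n‖)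
      = (1 / (2 * Real.pi)) * ‖fCoeff (deriv f) n‖ := by field_simp
  rw [this]
  have h3 : 1 / (2 * Real.pi) ≤ 1 := by
    rw [div_le_one (by positivity)]; linarith [Real.pi_gt_three]
  nlinarith [norm_nonneg (fCoeff (deriv f) n)]

lemma fCoeff_sum (N : ℕ) (f : ℕ → ℝ → ℝ) (hf : ∀ k < N, Continuous (f k)) (n : ℤ) :
    fCoeff (fun x => ∑ k ∈ Finset.range N, f k x) n = ∑ k ∈ Finset.range N, fCoeff (f k) n := by
  unfold fCoeff
  rw [← intervalIntegral.integral_finsetSum]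
  · congr 1
    ext x
    push_cast
    rw [Finset.mul_sum]
  · intro k hk
    have := hf k (Finset.mem_range.1 hk)
    apply Continuous.intervalIntegrable
    fun_prop

/-- telescoping bound for the multi-scale weights -/
lemma scale_sum (N : ℕ) (x : ℝ) (hx : 0 ≤ x) :
    ∑ k ∈ Finset.range N, x * (1/4:ℝ)^k / (1 + (x * (1/4:ℝ)^k)^2) ≤ 13/6 := by
  have key : ∀ t : ℝ, 0 ≤ t → t / (1 + t^2) ≤ 13/6 * (t / (1+t)) - 13/6 * ((t/4) / (1 + t/4)) := by
    intro t ht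
    have : 13/6 * (t / (1+t)) - 13/6 * ((t/4) / (1 + t/4)) = 13/2 * t / ((1+t)*(4+t)) := by
      field_simp
      ring
    rw [this, div_le_div_iff₀ (by positivity) (by positivity)]
    nlinarith [mul_nonneg ht (sq_nonneg (t-1)), ht]
  calc _ ≤ ∑ k ∈ Finset.range N, ((fun k : ℕ => 13/6 * ((x * (1/4:ℝ)^k) / (1 + x * (1/4:ℝ)^k))) k
        - (fun k : ℕ => 13/6 * ((x * (1/4:ℝ)^k) / (1 + x * (1/4:ℝ)^k))) (k+1)) := by
        apply Finset.sum_le_sum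
        intro k _
        have := key (x * (1/4:ℝ)^k) (by positivity)
        have e : x * (1/4:ℝ)^(k+1) = x * (1/4:ℝ)^k / 4 := by ring
        simp only [e]
        exact this
    _ ≤ 13/6 := by
        rw [Finset.sum_range_sub']
        have h1 : 0 ≤ 13/6 * ((x * (1/4:ℝ)^N) / (1 + x * (1/4:ℝ)^N)) := by positivity
        have h2 : x / (1 + x) ≤ 1 := by rw [div_le_one (by positivity)]; linarith
        simp only [pow_zero, mul_one]
        linarith

lemma geom_quarter (N : ℕ) : ∑ k ∈ Finset.range N, (1/4:ℝ)^k ≤ 4/3 := by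
  rw [geom_sum_eq (by norm_num)]
  have : (0:ℝ) ≤ (1/4:ℝ)^N := by positivity
  rw [div_le_iff_of_neg (by norm_num)]
  linarith

/-- weighted Cauchy-Schwarz across scales -/
lemma scale_cs (N : ℕ) (x : ℕ → ℝ) (m : ℝ) (hm : 0 ≤ m) :
    (1 + m) * (∑ k ∈ Finset.range N, x k)^2 ≤
      4 * ∑ k ∈ Finset.range N, (x k ^ 2 * 4^k + (m * x k)^2 * (1/4)^k) := by
  rcases Nat.eq_zero_or_pos N with rfl | hN
  · simp
  set g : ℕ → ℝ := fun k => (1/4:ℝ)^k / (1 + (m * (1/4:ℝ)^k)^2) with hg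
  have hgpos : ∀ k, 0 < g k := fun k => by positivity
  have h := Finset.sq_sum_div_le_sum_sq_div (Finset.range N) x (g := g) (fun i _ => hgpos i)
  have hG : 0 < ∑ k ∈ Finset.range N, g k :=
    Finset.sum_pos (fun i _ => hgpos i) (by simpa using hN.ne')
  rw [div_le_iff₀ hG] at h
  have hG1 : ∑ k ∈ Finset.range N, g k ≤ 4/3 := by
    refine le_trans (Finset.sum_le_sum ?_) (geom_quarter N)
    intro k _
    apply div_le_self (by positivity)
    nlinarith [sq_nonneg (m * (1/4:ℝ)^k)]
  have hG2 : m * ∑ k ∈ Finset.range N, g k ≤ 13/6 := by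
    refine le_trans (le_of_eq ?_) (scale_sum N m hm)
    rw [Finset.mul_sum]
    apply Finset.sum_congr rfl
    intro k _
    simp only [hg]; ring
  have hs : ∑ i ∈ Finset.range N, x i ^ 2 / g i
      = ∑ k ∈ Finset.range N, (x k ^ 2 * 4^k + (m * x k)^2 * (1/4)^k) := by
    apply Finset.sum_congr rfl
    intro k _
    simp only [hg]
    have : (4:ℝ)^k = ((1/4:ℝ)^k)⁻¹ := by rw [← inv_pow]; norm_num
    rw [this]
    have hp : (0:ℝ) < (1/4:ℝ)^k := by positivity
    generalize (1/4:ℝ)^k = p at *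
    field_simp
  rw [hs] at h
  set Q := ∑ k ∈ Finset.range N, (x k ^ 2 * 4^k + (m * x k)^2 * (1/4)^k) with hQ
  have hQ0 : 0 ≤ Q := Finset.sum_nonneg (fun k _ => by positivity)
  calc (1+m) * (∑ k ∈ Finset.range N, x k)^2 ≤ (1+m) * (Q * ∑ k ∈ Finset.range N, g k) := by
        gcongr
    _ = Q * (∑ k ∈ Finset.range N, g k + m * ∑ k ∈ Finset.range N, g k) := by ring
    _ ≤ Q * 4 := by gcongr; linarith
    _ = 4 * Q := by ring

lemma scalar_energy (N : ℕ) (f : ℕ → ℝ → ℝ) (hf : ∀ k < N, ContDiff ℝ 1 (f k))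
    (hp : ∀ k < N, Function.Periodic (f k) 1) (S : Finset ℤ) :
    ∑ n ∈ S, (1 + |(n:ℝ)|) * ‖fCoeff (fun x => ∑ k ∈ Finset.range N, f k x) n‖ ^ 2 ≤
      4 * ∑ k ∈ Finset.range N, ((∫ x in (0:ℝ)..1, f k x ^ 2) * 4^k
        + (∫ x in (0:ℝ)..1, deriv (f k) x ^ 2) * (1/4)^k) := by
  have h1 : ∀ n ∈ S, (1 + |(n:ℝ)|) * ‖fCoeff (fun x => ∑ k ∈ Finset.range N, f k x) n‖ ^ 2 ≤
      4 * ∑ k ∈ Finset.range N, (‖fCoeff (f k) n‖ ^ 2 * 4^k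
        + ‖fCoeff (deriv (f k)) n‖ ^2 * (1/4)^k) := by
    intro n _
    rw [fCoeff_sum N f (fun k hk => (hf k hk).continuous)]
    calc _ ≤ (1 + |(n:ℝ)|) * (∑ k ∈ Finset.range N, ‖fCoeff (f k) n‖)^2 := by
          gcongr; exact norm_sum_le _ _
      _ ≤ _ := scale_cs N _ _ (abs_nonneg _)
      _ ≤ _ := by
          gcongr with k hk
          exact fCoeff_deriv_norm _ (hf k (Finset.mem_range.1 hk)) (hp k (Finset.mem_range.1 hk)) n
  refine (Finset.sum_le_sum h1).trans ?_
  rw [← Finset.mul_sum, Finset.sum_comm]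
  gcongr with k hk
  rw [Finset.sum_add_distrib, ← Finset.sum_mul, ← Finset.sum_mul]
  have hk' := Finset.mem_range.1 hk
  gcongr
  · exact bessel_fCoeff _ (hf k hk').continuous S
  · exact bessel_fCoeff _ ((hf k hk').continuous_deriv le_rfl) S

lemma rpow_two_q_le (q : ℝ) (hq0 : 0 ≤ q) (hq : q ≤ 1/2) (n : ℤ) :
    |(n:ℝ)| ^ (2*q) ≤ 1 + |(n:ℝ)| := by
  rcases eq_or_ne n 0 with rfl | hn
  · rcases eq_or_lt_of_le hq0 with rfl | h
    · simp
    · rw [Int.cast_zero, abs_zero, Real.zero_rpow (by positivity)]; norm_num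
  · have h1 : (1:ℝ) ≤ |(n:ℝ)| := by exact_mod_cast Int.one_le_abs hn
    calc |(n:ℝ)| ^ (2*q) ≤ |(n:ℝ)| ^ (1:ℝ) := Real.rpow_le_rpow_of_exponent_le h1 (by linarith)
      _ ≤ _ := by rw [Real.rpow_one]; linarith

lemma norm_sq_eq_sum {d : ℕ} (v : Edim d) : ‖v‖^2 = ∑ i, v i ^ 2 := by
  rw [EuclideanSpace.norm_sq_eq]; simp

lemma integral_norm_sq_eq {d : ℕ} (f : ℝ → Edim d) (hf : Continuous f) :
    ∑ i, ∫ x in (0:ℝ)..1, f x i ^ 2 = ∫ x in (0:ℝ)..1, ‖f x‖^2 := by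
  rw [← intervalIntegral.integral_finsetSum]
  · simp only [norm_sq_eq_sum]
  · intro i _
    apply Continuous.intervalIntegrable
    fun_prop

lemma contDiff_comp_coord {d : ℕ} (f : ℝ → Edim d) (hf : ContDiff ℝ 1 f) (i : Fin d) :
    ContDiff ℝ 1 (fun x => f x i) := by
  exact (EuclideanSpace.proj (𝕜 := ℝ) i).contDiff.comp hf

lemma deriv_coord {d : ℕ} (f : ℝ → Edim d) (hf : ContDiff ℝ 1 f) (i : Fin d) (x : ℝ) :
    deriv (fun x => f x i) x = deriv f x i := by
  have h := ((hf.differentiable one_ne_zero) x).hasDerivAt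
  have := ((EuclideanSpace.proj (𝕜 := ℝ) i).hasFDerivAt (x := f x)).comp_hasDerivAt x h
  exact this.deriv

lemma vector_energy {d : ℕ} (q : ℝ) (hq0 : 0 ≤ q) (hq : q ≤ 1/2)
    (N : ℕ) (f : ℕ → ℝ → Edim d) (hf : ∀ k < N, ContDiff ℝ 1 (f k))
    (hp : ∀ k < N, Function.Periodic (f k) 1) (A : ℝ)
    (h0 : ∀ k < N, ∫ x in (0:ℝ)..1, ‖f k x‖^2 ≤ A * (1/4)^k)
    (h1 : ∀ k < N, ∫ x in (0:ℝ)..1, ‖deriv (f k) x‖^2 ≤ A * 4^k) :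
    homSobSq q (fun x => ∑ k ∈ Finset.range N, f k x) ≤ 8 * (N * A) ∧
    L2Sq (fun x => ∑ k ∈ Finset.range N, f k x) ≤ 8 * (N * A) := by
  have h4 : ∀ k : ℕ, (1/4:ℝ)^k * 4^k = 1 := fun k => by rw [← mul_pow]; norm_num
  have hN : ∑ k ∈ Finset.range N, (A + A) = 2 * (N * A) := by simp; ring
  constructor
  · unfold homSobSq
    apply Real.tsum_le_of_sum_le
    · intro n
      exact mul_nonneg (by positivity) (Finset.sum_nonneg (fun i _ => by positivity))
    intro S
    calc ∑ n ∈ S, |(n:ℝ)| ^ (2*q) * coeffNormSq (fun x => ∑ k ∈ Finset.range N, f k x) n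
        ≤ ∑ n ∈ S, ∑ i, (1 + |(n:ℝ)|) *
            ‖fCoeff (fun x => ∑ k ∈ Finset.range N, f k x i) n‖ ^ 2 := by
          apply Finset.sum_le_sum
          intro n _
          rw [← Finset.mul_sum]
          have e : coeffNormSq (fun x => ∑ k ∈ Finset.range N, f k x) n =
            ∑ i, ‖fCoeff (fun x => ∑ k ∈ Finset.range N, f k x i) n‖ ^ 2 := by
            simp [coeffNormSq]
          rw [e]
          gcongr
          exact rpow_two_q_le q hq0 hq n
      _ ≤ ∑ i, 4 * ∑ k ∈ Finset.range N, ((∫ x in (0:ℝ)..1, f k x i ^ 2) * 4^k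
        + (∫ x in (0:ℝ)..1, deriv (fun x => f k x i) x ^ 2) * (1/4)^k) := by
          rw [Finset.sum_comm]
          apply Finset.sum_le_sum
          intro i _
          refine scalar_energy N (fun k x => f k x i) ?_ ?_ S
          · exact fun k hk => contDiff_comp_coord _ (hf k hk) i
          · intro k hk x
            simp only [hp k hk x]
      _ = 4 * ∑ k ∈ Finset.range N, ((∫ x in (0:ℝ)..1, ‖f k x‖ ^ 2) * 4^k
        + (∫ x in (0:ℝ)..1, ‖deriv (f k) x‖ ^ 2) * (1/4)^k) := by
          rw [← Finset.mul_sum, Finset.sum_comm]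
          congr 1
          apply Finset.sum_congr rfl
          intro k hk
          have hk' := Finset.mem_range.1 hk
          rw [Finset.sum_add_distrib, ← Finset.sum_mul, ← Finset.sum_mul,
            ← integral_norm_sq_eq _ (hf k hk').continuous,
            ← integral_norm_sq_eq _ ((hf k hk').continuous_deriv le_rfl)]
          simp only [deriv_coord _ (hf k hk')]
      _ ≤ 4 * ∑ k ∈ Finset.range N, (A + A) := by
          gcongr with k hk
          · calc _ ≤ A * (1/4)^k * 4^k := by gcongr; exact h0 k (Finset.mem_range.1 hk)
              _ = A := by rw [mul_assoc, h4, mul_one]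
          · calc _ ≤ A * 4^k * (1/4)^k := by gcongr; exact h1 k (Finset.mem_range.1 hk)
              _ = A := by rw [mul_assoc, mul_comm (4^k), h4, mul_one]
      _ = _ := by rw [hN]; ring
  · unfold L2Sq
    have hc : ∀ k ∈ Finset.range N, Continuous (f k) :=
      fun k hk => (hf k (Finset.mem_range.1 hk)).continuous
    calc ∫ θ in (0:ℝ)..1, ‖∑ k ∈ Finset.range N, f k θ‖ ^ 2
        ≤ ∫ θ in (0:ℝ)..1, 4 * ∑ k ∈ Finset.range N, ‖f k θ‖ ^2 * 4^k := by
          apply intervalIntegral.integral_mono_on zero_le_one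
          · apply Continuous.intervalIntegrable
            exact (continuous_finsetSum _ hc).norm.pow 2
          · apply Continuous.intervalIntegrable
            exact continuous_const.mul (continuous_finsetSum _
              (fun k hk => ((hc k hk).norm.pow 2).mul continuous_const))
          · intro x _
            have := scale_cs N (fun k => ‖f k x‖) 0 le_rfl
            simp only [add_zero, one_mul, zero_mul, ne_eq, OfNat.ofNat_ne_zero, not_false_eq_true,
              zero_pow] at this
            refine le_trans ?_ this
            gcongr
            exact norm_sum_le _ _
      _ = 4 * ∑ k ∈ Finset.range N, (∫ x in (0:ℝ)..1, ‖f k x‖ ^ 2) * 4^k := by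
          rw [intervalIntegral.integral_const_mul, intervalIntegral.integral_finsetSum]
          · simp only [intervalIntegral.integral_mul_const]
          · intro k hk
            exact (((hc k hk).norm.pow 2).mul continuous_const).intervalIntegrable _ _
      _ ≤ 4 * ∑ k ∈ Finset.range N, A := by
          gcongr with k hk
          calc _ ≤ A * (1/4)^k * 4^k := by gcongr; exact h0 k (Finset.mem_range.1 hk)
              _ = A := by rw [mul_assoc, h4, mul_one]
      _ ≤ 8 * (N * A) := by
          rcases Nat.eq_zero_or_pos N with rfl | hN0
          · simp
          have hA : 0 ≤ A := by
            have := h0 0 hN0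
            have h2 : 0 ≤ ∫ x in (0:ℝ)..1, ‖f 0 x‖^2 :=
              intervalIntegral.integral_nonneg zero_le_one (fun _ _ => by positivity)
            simp at this
            linarith
          simp only [Finset.sum_const, Finset.card_range, nsmul_eq_mul]
          have : 0 ≤ (N:ℝ) * A := by positivity
          linarith

/-! ### Periodic functions and circle maps -/

lemma periodic_bdd {E : Type*} [NormedAddCommGroup E] (f : ℝ → E) (hf : Continuous f)
    (hp : Function.Periodic f 1) : ∃ M : ℝ, 0 < M ∧ ∀ x, ‖f x‖ ≤ M := by
  obtain ⟨M, hM⟩ := (isCompact_Icc (a := (0:ℝ)) (b := 1)).exists_bound_of_continuousOn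
    hf.continuousOn
  refine ⟨max M 1, by positivity, fun x => ?_⟩
  obtain ⟨y, hy, hxy⟩ := hp.exists_mem_Ico₀ zero_lt_one x
  rw [hxy]
  exact (hM y ⟨hy.1, hy.2.le⟩).trans (le_max_left _ _)

lemma periodic_pos (f : ℝ → ℝ) (hf : Continuous f)
    (hp : Function.Periodic f 1) (hpos : ∀ x, 0 < f x) : ∃ m : ℝ, 0 < m ∧ ∀ x, m ≤ f x := by
  obtain ⟨z, hz, hM⟩ := (isCompact_Icc (a := (0:ℝ)) (b := 1)).exists_isMinOn
    ⟨0, by simp⟩ hf.continuousOn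
  refine ⟨f z, hpos z, fun x => ?_⟩
  obtain ⟨y, hy, hxy⟩ := hp.exists_mem_Ico₀ zero_lt_one x
  rw [hxy]
  exact hM ⟨hy.1, hy.2.le⟩

lemma periodic_deriv {E : Type*} [NormedAddCommGroup E] [NormedSpace ℝ E] (f : ℝ → E)
    (hp : Function.Periodic f 1) : Function.Periodic (deriv f) 1 := by
  intro x
  rw [← deriv_comp_add_const]
  congr 1
  ext y
  exact hp y

lemma deriv_periodic_of_shift (f : ℝ → ℝ) (T : ℝ)
    (hp : ∀ x, f (x + 1) = f x + T) : Function.Periodic (deriv f) 1 := by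
  intro x
  rw [← deriv_comp_add_const]
  have : (fun x => f (x + 1)) = fun x => f x + T := funext hp
  rw [this, deriv_add_const]

lemma exists_inverse (P : ℝ → ℝ) (T : ℝ) (hT : 0 < T) (hP : ContDiff ℝ (⊤ : ℕ∞) P)
    (hper : ∀ x, P (x + 1) = P x + T) (hpos : ∀ x, 0 < deriv P x) :
    ∃ Q : ℝ → ℝ, ContDiff ℝ (⊤ : ℕ∞) Q ∧ (∀ x, Q (P x) = x) ∧ (∀ y, P (Q y) = y) ∧
      (∀ y, Q (y + T) = Q y + 1) ∧ (∀ y, HasDerivAt Q (deriv P (Q y))⁻¹ y) ∧ StrictMono P := by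
  have hmono : StrictMono P := strictMono_of_deriv_pos hpos
  have hnat : ∀ n : ℕ, P n = P 0 + n * T ∧ P (-n) = P 0 - n * T := by
    intro n
    induction n with
    | zero => simp
    | succ n ih =>
      constructor
      · push_cast; rw [hper, ih.1]; ring
      · have := hper (-((n+1 : ℕ):ℝ))
        have e : -((n+1 : ℕ):ℝ) + 1 = -n := by push_cast; ring
        rw [e, ih.2] at this
        push_cast at this ⊢
        linarith
  have hsurj : Function.Surjective P := by
    intro y
    obtain ⟨n, hn⟩ := exists_nat_ge (|y - P 0| / T)
    rw [div_le_iff₀ hT] at hn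
    have h1 := (abs_le.1 hn)
    exact mem_range_of_exists_le_of_exists_ge hP.continuous
      ⟨-n, by rw [(hnat n).2]; linarith [h1.1]⟩ ⟨n, by rw [(hnat n).1]; linarith [h1.2]⟩
  let e := (hmono.orderIsoOfSurjective P hsurj).toHomeomorph
  have he : ∀ x, e x = P x := fun x => rfl
  have hdiff : ∀ x, HasDerivAt P (deriv P x) x :=
    fun x => ((hP.differentiable (by simp)) x).hasDerivAt
  have hQP : ∀ x, e.symm (P x) = x := fun x => by rw [← he, e.symm_apply_apply]
  have hPQ : ∀ y, P (e.symm y) = y := fun y => by rw [← he, e.apply_symm_apply]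
  refine ⟨e.symm, ?_, hQP, hPQ, ?_, ?_, hmono⟩
  · exact e.contDiff_symm_deriv (fun x => (hpos x).ne') hdiff hP
  · intro y
    apply hmono.injective
    rw [hPQ, hper, hPQ]
  · intro y
    exact HasDerivAt.of_local_left_inverse (e.symm.continuous.continuousAt) (hdiff _)
      (hpos _).ne' (Filter.Eventually.of_forall hPQ)

/-! ### Arc length reparametrization -/

lemma Imm.differentiable {d : ℕ} {γ : ℝ → Edim d} (hγ : γ ∈ Imm d) : Differentiable ℝ γ :=
  hγ.2.1.differentiable (by simp)

lemma Imm.contDiff_deriv {d : ℕ} {γ : ℝ → Edim d} (hγ : γ ∈ Imm d) :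
    ContDiff ℝ (⊤ : ℕ∞) (deriv γ) := (contDiff_infty_iff_deriv.1 hγ.2.1).2

lemma IsCircleDiffeo.differentiable {Ψ : ℝ → ℝ} (h : IsCircleDiffeo Ψ) : Differentiable ℝ Ψ :=
  h.1.differentiable (by simp)

lemma IsCircleDiffeo.contDiff_deriv {Ψ : ℝ → ℝ} (h : IsCircleDiffeo Ψ) :
    ContDiff ℝ (⊤ : ℕ∞) (deriv Ψ) := (contDiff_infty_iff_deriv.1 h.1).2

lemma Imm.comp {d : ℕ} {γ : ℝ → Edim d} (hγ : γ ∈ Imm d) {Ψ : ℝ → ℝ} (h : IsCircleDiffeo Ψ) :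
    γ ∘ Ψ ∈ Imm d := by
  refine ⟨fun x => ?_, hγ.2.1.comp h.1, fun x => ?_⟩
  · simp only [Function.comp, h.2.1]; exact hγ.1 _
  · have := HasDerivAt.scomp x ((Imm.differentiable hγ) (Ψ x)).hasDerivAt
      (h.differentiable x).hasDerivAt
    rw [this.deriv]
    exact smul_ne_zero (h.2.2 x).ne' (hγ.2.2 _)

lemma IsCircleDiffeo.comp {Φ Ψ : ℝ → ℝ} (h1 : IsCircleDiffeo Φ) (h2 : IsCircleDiffeo Ψ) :
    IsCircleDiffeo (Φ ∘ Ψ) := by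
  refine ⟨h1.1.comp h2.1, fun x => ?_, fun x => ?_⟩
  · simp only [Function.comp, h2.2.1, h1.2.1]
  · have := HasDerivAt.comp x (h1.differentiable (Ψ x)).hasDerivAt (h2.differentiable x).hasDerivAt
    rw [this.deriv]
    exact mul_pos (h1.2.2 _) (h2.2.2 _)

lemma IsCircleDiffeo.exists_inv {Φ : ℝ → ℝ} (h : IsCircleDiffeo Φ) :
    ∃ Q, IsCircleDiffeo Q ∧ (∀ x, Q (Φ x) = x) ∧ (∀ y, Φ (Q y) = y) ∧
      (∀ y, HasDerivAt Q (deriv Φ (Q y))⁻¹ y) ∧ StrictMono Φ := by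
  obtain ⟨Q, h1, h2, h3, h4, h5, h6⟩ := exists_inverse Φ 1 one_pos h.1 h.2.1 h.2.2
  refine ⟨Q, ⟨h1, h4, fun y => ?_⟩, h2, h3, h5, h6⟩
  rw [(h5 y).deriv]
  exact inv_pos.2 (h.2.2 _)

lemma IsCircleDiffeo.add_const {Φ : ℝ → ℝ} (h : IsCircleDiffeo Φ) (a : ℝ) :
    IsCircleDiffeo (fun x => Φ x + a) := by
  refine ⟨h.1.add contDiff_const, fun x => ?_, fun x => ?_⟩
  · simp only [h.2.1]; ring
  · rw [deriv_add_const]; exact h.2.2 x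

lemma IsCircleDiffeo.comp_add_const {Φ : ℝ → ℝ} (h : IsCircleDiffeo Φ) (a : ℝ) :
    IsCircleDiffeo (fun x => Φ (x + a)) := by
  refine ⟨h.1.comp (contDiff_id.add contDiff_const), fun x => ?_, fun x => ?_⟩
  · change Φ (x + 1 + a) = Φ (x + a) + 1
    rw [add_right_comm, h.2.1]
  · rw [deriv_comp_add_const]; exact h.2.2 _

lemma Imm.continuous_speed {d : ℕ} {γ : ℝ → Edim d} (hγ : γ ∈ Imm d) :
    Continuous (fun x => ‖deriv γ x‖) := (Imm.contDiff_deriv hγ).continuous.norm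

lemma Imm.curveLen_pos {d : ℕ} {γ : ℝ → Edim d} (hγ : γ ∈ Imm d) : 0 < curveLen γ := by
  apply intervalIntegral.intervalIntegral_pos_of_pos_on
  · exact (Imm.continuous_speed hγ).intervalIntegrable _ _
  · intro x _
    exact norm_pos_iff.2 (hγ.2.2 x)
  · exact one_pos

lemma Imm.hasDerivAt_psi {d : ℕ} {γ : ℝ → Edim d} (hγ : γ ∈ Imm d) (x : ℝ) :
    HasDerivAt (psi γ) ((curveLen γ)⁻¹ * ‖deriv γ x‖) x := by
  apply HasDerivAt.const_mul
  have hc := Imm.continuous_speed hγ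
  exact intervalIntegral.integral_hasDerivAt_right (hc.intervalIntegrable _ _)
    (hc.stronglyMeasurableAtFilter _ _) hc.continuousAt

lemma Imm.psi_diffeo {d : ℕ} {γ : ℝ → Edim d} (hγ : γ ∈ Imm d) : IsCircleDiffeo (psi γ) := by
  have hl := Imm.curveLen_pos hγ
  have hd : deriv (psi γ) = fun x => (curveLen γ)⁻¹ * ‖deriv γ x‖ :=
    funext fun x => (Imm.hasDerivAt_psi hγ x).deriv
  refine ⟨?_, fun x => ?_, fun x => ?_⟩
  · rw [contDiff_infty_iff_deriv]
    refine ⟨fun x => (Imm.hasDerivAt_psi hγ x).differentiableAt, ?_⟩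
    rw [hd]
    exact contDiff_const.mul ((Imm.contDiff_deriv hγ).norm ℝ hγ.2.2)
  · have hc := Imm.continuous_speed hγ
    have hper : Function.Periodic (fun x => ‖deriv γ x‖) 1 := fun x => by
      simp only [periodic_deriv γ hγ.1 x]
    have h1 := hper.intervalIntegral_add_eq x 0
    have h2 := intervalIntegral.integral_add_adjacent_intervals
      (hc.intervalIntegrable (μ := volume) 0 x) (hc.intervalIntegrable x (x+1))
    unfold psi
    rw [← h2, h1, zero_add, mul_add]
    congr 1
    change (curveLen γ)⁻¹ * curveLen γ = 1
    exact inv_mul_cancel₀ hl.ne'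
  · rw [hd]
    exact mul_pos (inv_pos.2 hl) (norm_pos_iff.2 (hγ.2.2 x))

lemma Imm.arc_comp {d : ℕ} {γ : ℝ → Edim d} (hγ : γ ∈ Imm d) {Ψ : ℝ → ℝ} (h : IsCircleDiffeo Ψ)
    (θ : ℝ) : ∫ σ in (0:ℝ)..θ, ‖deriv (γ ∘ Ψ) σ‖ = ∫ σ in (Ψ 0)..(Ψ θ), ‖deriv γ σ‖ := by
  rw [← intervalIntegral.integral_comp_mul_deriv (f := Ψ) (f' := deriv Ψ)
    (fun x _ => (h.differentiable x).hasDerivAt) (h.contDiff_deriv.continuous.continuousOn)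
    (Imm.continuous_speed hγ)]
  congr 1
  ext x
  have := HasDerivAt.scomp x ((Imm.differentiable hγ) (Ψ x)).hasDerivAt
      (h.differentiable x).hasDerivAt
  rw [this.deriv, norm_smul, Real.norm_of_nonneg (h.2.2 x).le]
  simp [mul_comm]

lemma Imm.curveLen_comp {d : ℕ} {γ : ℝ → Edim d} (hγ : γ ∈ Imm d) {Ψ : ℝ → ℝ}
    (h : IsCircleDiffeo Ψ) : curveLen (γ ∘ Ψ) = curveLen γ := by
  have hper : Function.Periodic (fun x => ‖deriv γ x‖) 1 := fun x => by
    simp only [periodic_deriv γ hγ.1 x]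
  have h1 : Ψ 1 = Ψ 0 + 1 := by simpa using h.2.1 0
  have := Imm.arc_comp hγ h 1
  rw [h1, hper.intervalIntegral_add_eq (Ψ 0) 0, zero_add] at this
  exact this

lemma Imm.psi_comp {d : ℕ} {γ : ℝ → Edim d} (hγ : γ ∈ Imm d) {Ψ : ℝ → ℝ}
    (h : IsCircleDiffeo Ψ) (θ : ℝ) : psi (γ ∘ Ψ) θ = psi γ (Ψ θ) - psi γ (Ψ 0) := by
  have hc := Imm.continuous_speed hγ
  unfold psi
  rw [Imm.curveLen_comp hγ h, Imm.arc_comp hγ h, ← mul_sub,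
    intervalIntegral.integral_interval_sub_left (hc.intervalIntegrable _ _)
    (hc.intervalIntegrable _ _)]

lemma change_var_le (κ : ℝ → ℝ) (hκ : IsCircleDiffeo κ) (k0 : ℝ) (hk0 : 0 < k0)
    (hk : ∀ x, k0 ≤ deriv κ x) (g : ℝ → ℝ) (hg : Continuous g) (hp : Function.Periodic g 1)
    (hg0 : ∀ x, 0 ≤ g x) :
    ∫ s in (0:ℝ)..1, g (κ s) ≤ k0⁻¹ * ∫ s in (0:ℝ)..1, g s := by
  have h1 : κ 1 = κ 0 + 1 := by simpa using hκ.2.1 0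
  have h2 := intervalIntegral.integral_comp_mul_deriv (f := κ) (f' := deriv κ) (a := 0) (b := 1)
    (fun x _ => (hκ.differentiable x).hasDerivAt) (hκ.contDiff_deriv.continuous.continuousOn)
    hg
  rw [h1, hp.intervalIntegral_add_eq (κ 0) 0, zero_add] at h2
  rw [← h2, ← intervalIntegral.integral_const_mul]
  have hcκ := hκ.1.continuous
  have hcκ' := hκ.contDiff_deriv.continuous
  apply intervalIntegral.integral_mono_on zero_le_one
  · exact (hg.comp hcκ).intervalIntegrable _ _
  · apply Continuous.intervalIntegrable
    exact continuous_const.mul ((hg.comp hcκ).mul hcκ')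
  · intro x _
    have := hk x
    have h0 := hg0 (κ x)
    simp only [Function.comp]
    calc g (κ x) = k0⁻¹ * (g (κ x) * k0) := by field_simp
      _ ≤ _ := by gcongr

/-- The main energy estimate. -/
lemma energy {d : ℕ} (q : ℝ) (hq0 : 0 ≤ q) (hq : q ≤ 1/2) (γ : ℝ → Edim d) (hγ : γ ∈ Imm d) :
    ∃ C : ℝ, 0 < C ∧ ∀ Ψ : ℝ → ℝ, IsCircleDiffeo Ψ → ∀ (N : ℕ) (U : ℕ → ℝ → ℝ) (A : ℝ),
      (∀ k < N, ContDiff ℝ 1 (U k)) → (∀ k < N, Function.Periodic (U k) 1) →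
      (∀ k < N, ∫ x in (0:ℝ)..1, U k x ^ 2 ≤ A * (1/4)^k) →
      (∀ k < N, ∫ x in (0:ℝ)..1, deriv (U k) x ^ 2 ≤ A * 4^k) →
      Gnorm q (γ ∘ Ψ) (fun θ => (∑ k ∈ Finset.range N, U k (Ψ θ)) • deriv γ (Ψ θ)) ≤
        C * √(N * A) := by
  have hl := Imm.curveLen_pos hγ
  set l := curveLen γ with hldef
  have hψ := Imm.psi_diffeo hγ
  obtain ⟨κ₀, hκ₀, hκψ, hψκ, -, hψmono⟩ := hψ.exists_inv
  have hγ' := Imm.contDiff_deriv hγ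
  have hγ'' := (contDiff_infty_iff_deriv.1 hγ').2
  obtain ⟨M1, hM1, hM1b⟩ := periodic_bdd _ hγ'.continuous (periodic_deriv _ hγ.1)
  obtain ⟨M2, hM2, hM2b⟩ := periodic_bdd _ hγ''.continuous
    (periodic_deriv _ (periodic_deriv _ hγ.1))
  have hκper := deriv_periodic_of_shift κ₀ 1 hκ₀.2.1
  obtain ⟨k0, hk0, hk0b⟩ := periodic_pos _ hκ₀.contDiff_deriv.continuous hκper hκ₀.2.2
  obtain ⟨k1, hk1, hk1b⟩ := periodic_bdd _ hκ₀.contDiff_deriv.continuous hκper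
  set B := k0⁻¹ * (M1^2 + 2*k1^2*(M1^2+M2^2)) with hB
  have hBpos : 0 < B := by positivity
  set D := (l + l^(1-2*q)) * (8 * B) with hD
  have hDpos : 0 < D := by positivity
  refine ⟨√D, Real.sqrt_pos.2 hDpos, ?_⟩
  intro Ψ hΨ N U A hU hUp h0 h1
  set a := psi γ (Ψ 0) with ha
  set κ : ℝ → ℝ := fun s => κ₀ (s + a) with hκdef
  have hκ : IsCircleDiffeo κ := hκ₀.comp_add_const a
  have hκd : ∀ s, deriv κ s = deriv κ₀ (s + a) := fun s => deriv_comp_add_const ..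
  have hk0c : ∀ x, k0 ≤ deriv κ x := fun x => by rw [hκd]; exact hk0b _
  have hk1c : ∀ x, |deriv κ x| ≤ k1 := fun x => by rw [hκd]; exact hk1b _
  have hcomp := Imm.comp hγ hΨ
  have hψ2 := Imm.psi_diffeo hcomp
  obtain ⟨κ₂, -, hκψ2, hψκ2, -, hψmono2⟩ := hψ2.exists_inv
  have hinv : ∀ s, Ψ (psiInv (γ ∘ Ψ) s) = κ s := by
    intro s
    have e1 : psi (γ ∘ Ψ) (psiInv (γ ∘ Ψ) s) = s :=
      Function.invFun_eq ⟨κ₂ s, hψκ2 s⟩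
    rw [Imm.psi_comp hγ hΨ] at e1
    apply hψmono.injective
    simp only [hκdef, hψκ]
    linarith
  set f : ℕ → ℝ → Edim d := fun k s => U k (κ s) • deriv γ (κ s) with hf
  have hfun : (fun θ => (∑ k ∈ Finset.range N, U k (Ψ θ)) • deriv γ (Ψ θ)) ∘ psiInv (γ ∘ Ψ)
      = fun s => ∑ k ∈ Finset.range N, f k s := by
    ext1 s
    simp only [Function.comp_apply, hinv, hf, Finset.sum_smul]
  have hfC : ∀ k < N, ContDiff ℝ 1 (f k) := fun k hk =>
    ((hU k hk).comp (hκ.1.of_le (by simp))).smul ((hγ'.comp hκ.1).of_le (by simp))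
  have hfp : ∀ k < N, Function.Periodic (f k) 1 := fun k hk s => by
    simp only [hf, hκ.2.1, hUp k hk (κ s), periodic_deriv _ hγ.1 (κ s)]
  have hUc : ∀ k < N, Continuous (fun x => U k x ^ 2) := fun k hk => (hU k hk).continuous.pow 2
  have hUc' : ∀ k < N, Continuous (fun x => deriv (U k) x ^ 2) :=
    fun k hk => ((hU k hk).continuous_deriv le_rfl).pow 2
  have hIU : ∀ k < N, ∫ s in (0:ℝ)..1, U k (κ s) ^ 2 ≤ k0⁻¹ * (A * (1/4)^k) := by
    intro k hk
    refine (change_var_le κ hκ k0 hk0 hk0c _ (hUc k hk) ?_ (fun x => by positivity)).trans ?_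
    · intro x
      simp only [hUp k hk x]
    · gcongr
      exact h0 k hk
  have hIU' : ∀ k < N, ∫ s in (0:ℝ)..1, deriv (U k) (κ s) ^ 2 ≤ k0⁻¹ * (A * 4^k) := by
    intro k hk
    refine (change_var_le κ hκ k0 hk0 hk0c _ (hUc' k hk) ?_ (fun x => by positivity)).trans ?_
    · intro x
      simp only [periodic_deriv _ (hUp k hk) x]
    · gcongr
      exact h1 k hk
  have hA : ∀ k < N, 0 ≤ A := by
    intro k hk
    have h2 : 0 ≤ ∫ x in (0:ℝ)..1, U k x^2 :=
      intervalIntegral.integral_nonneg zero_le_one (fun _ _ => by positivity)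
    have h3 := h2.trans (h0 k hk)
    exact nonneg_of_mul_nonneg_left h3 (by positivity)
  have hf0 : ∀ k < N, ∫ x in (0:ℝ)..1, ‖f k x‖^2 ≤ (B * A) * (1/4)^k := by
    intro k hk
    have hAk := hA k hk
    calc ∫ x in (0:ℝ)..1, ‖f k x‖^2 ≤ ∫ x in (0:ℝ)..1, M1^2 * U k (κ x)^2 := by
          apply intervalIntegral.integral_mono_on zero_le_one
          · exact ((hfC k hk).continuous.norm.pow 2).intervalIntegrable _ _
          · exact (continuous_const.mul ((hUc k hk).comp hκ.1.continuous)).intervalIntegrable _ _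
          · intro x _
            simp only [hf, norm_smul, mul_pow, Real.norm_eq_abs, sq_abs]
            rw [mul_comm]
            gcongr
            exact hM1b _
      _ ≤ M1^2 * (k0⁻¹ * (A * (1/4)^k)) := by
          rw [intervalIntegral.integral_const_mul]
          gcongr
          exact hIU k hk
      _ = (k0⁻¹ * M1^2 * A) * (1/4)^k := by ring
      _ ≤ _ := by
          gcongr
          rw [hB]
          gcongr
          have : 0 ≤ 2*k1^2*(M1^2+M2^2) := by positivity
          linarith
  have hderiv : ∀ k < N, ∀ x, deriv (f k) x =
      deriv κ x • (deriv (U k) (κ x) • deriv γ (κ x) + U k (κ x) • deriv (deriv γ) (κ x)) := by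
    intro k hk x
    have e1 : HasDerivAt (fun y => U k y • deriv γ y)
        (U k (κ x) • deriv (deriv γ) (κ x) + deriv (U k) (κ x) • deriv γ (κ x)) (κ x) :=
      (((hU k hk).differentiable one_ne_zero) (κ x)).hasDerivAt.smul
        ((hγ'.differentiable (by simp)) (κ x)).hasDerivAt
    have e2 := HasDerivAt.scomp x e1 (hκ.differentiable x).hasDerivAt
    rw [add_comm (deriv (U k) (κ x) • deriv γ (κ x))]
    exact e2.deriv
  have hf1 : ∀ k < N, ∫ x in (0:ℝ)..1, ‖deriv (f k) x‖^2 ≤ (B * A) * 4^k := by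
    intro k hk
    have hAk := hA k hk
    calc ∫ x in (0:ℝ)..1, ‖deriv (f k) x‖^2
        ≤ ∫ x in (0:ℝ)..1, (2*k1^2*M1^2 * deriv (U k) (κ x)^2 + 2*k1^2*M2^2 * U k (κ x)^2) := by
          apply intervalIntegral.integral_mono_on zero_le_one
          · exact (((hfC k hk).continuous_deriv le_rfl).norm.pow 2).intervalIntegrable _ _
          · exact ((continuous_const.mul ((hUc' k hk).comp hκ.1.continuous)).add
              (continuous_const.mul ((hUc k hk).comp hκ.1.continuous))).intervalIntegrable _ _
          · intro x _
            rw [hderiv k hk x, norm_smul, mul_pow, Real.norm_eq_abs]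
            have n1 : ‖deriv (U k) (κ x) • deriv γ (κ x) + U k (κ x) • deriv (deriv γ) (κ x)‖
                ≤ |deriv (U k) (κ x)| * M1 + |U k (κ x)| * M2 := by
              refine (norm_add_le _ _).trans ?_
              rw [norm_smul, norm_smul, Real.norm_eq_abs, Real.norm_eq_abs]
              gcongr
              · exact hM1b _
              · exact hM2b _
            calc _ ≤ k1^2 * (|deriv (U k) (κ x)| * M1 + |U k (κ x)| * M2)^2 := by
                  gcongr
                  exact hk1c x
              _ ≤ k1^2 * (2 * ((|deriv (U k) (κ x)| * M1)^2 + (|U k (κ x)| * M2)^2)) := by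
                  gcongr
                  exact add_sq_le
              _ = _ := by rw [mul_pow, mul_pow, sq_abs, sq_abs]; ring
      _ ≤ 2*k1^2*M1^2 * (k0⁻¹ * (A * 4^k)) + 2*k1^2*M2^2 * (k0⁻¹ * (A * (1/4)^k)) := by
          have i1 : IntervalIntegrable (fun x => 2*k1^2*M1^2 * deriv (U k) (κ x)^2) volume 0 1 :=
            (continuous_const.mul ((hUc' k hk).comp hκ.1.continuous)).intervalIntegrable _ _
          have i2 : IntervalIntegrable (fun x => 2*k1^2*M2^2 * U k (κ x)^2) volume 0 1 :=
            (continuous_const.mul ((hUc k hk).comp hκ.1.continuous)).intervalIntegrable _ _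
          rw [intervalIntegral.integral_add i1 i2,
            intervalIntegral.integral_const_mul, intervalIntegral.integral_const_mul]
          gcongr
          · exact hIU' k hk
          · exact hIU k hk
      _ ≤ 2*k1^2*M1^2 * (k0⁻¹ * (A * 4^k)) + 2*k1^2*M2^2 * (k0⁻¹ * (A * 4^k)) := by
          gcongr
          norm_num
      _ = (k0⁻¹ * (2*k1^2*(M1^2+M2^2))) * A * 4^k := by ring
      _ ≤ _ := by
          gcongr
          rw [hB]
          gcongr
          have : 0 ≤ M1^2 := by positivity
          linarith
  obtain ⟨r1, r2⟩ := vector_energy q hq0 hq N f hfC hfp (B*A) hf0 hf1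
  have hG : GSq q (γ ∘ Ψ) (fun θ => (∑ k ∈ Finset.range N, U k (Ψ θ)) • deriv γ (Ψ θ))
      ≤ D * (N * A) := by
    unfold GSq G0Sq GdotSq
    rw [hfun, Imm.curveLen_comp hγ hΨ, ← hldef]
    calc _ ≤ l * (8 * (N * (B*A))) + l^(1-2*q) * (8 * (N * (B*A))) := by gcongr
      _ = D * (N * A) := by rw [hD]; ring
  unfold Gnorm
  rw [← Real.sqrt_mul hDpos.le]
  exact Real.sqrt_le_sqrt hG

/-! ### Concatenable paths -/

lemma fCoeff_smul (a : ℝ) (f : ℝ → ℝ) (n : ℤ) :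
    fCoeff (fun θ => a * f θ) n = (a : ℂ) * fCoeff f n := by
  unfold fCoeff
  rw [← intervalIntegral.integral_const_mul]
  congr 1
  ext θ
  push_cast
  ring

lemma Gnorm_smul {d : ℕ} (q a : ℝ) (c h : ℝ → Edim d) :
    Gnorm q c (fun θ => a • h θ) = |a| * Gnorm q c h := by
  have h1 : ∀ n, coeffNormSq ((fun θ => a • h θ) ∘ psiInv c) n
      = a^2 * coeffNormSq (h ∘ psiInv c) n := by
    intro n
    unfold coeffNormSq
    rw [Finset.mul_sum]
    refine Finset.sum_congr rfl fun i _ => ?_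
    have := fCoeff_smul a (fun θ => (h ∘ psiInv c) θ i) n
    simp only [Function.comp, PiLp.smul_apply, smul_eq_mul] at this ⊢
    rw [this, norm_mul, mul_pow, Complex.norm_real, Real.norm_eq_abs, sq_abs]
  have h2 : GSq q c (fun θ => a • h θ) = a^2 * GSq q c h := by
    unfold GSq G0Sq GdotSq homSobSq L2Sq
    simp only [h1]
    have : ∀ n : ℤ, |(n:ℝ)| ^ (2*q) * (a^2 * coeffNormSq (h ∘ psiInv c) n) =
      a^2 * (|(n:ℝ)| ^ (2*q) * coeffNormSq (h ∘ psiInv c) n) := fun n => by ring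
    simp only [this]
    rw [tsum_mul_left]
    simp only [Function.comp, norm_smul, mul_pow, Real.norm_eq_abs, sq_abs]
    rw [intervalIntegral.integral_const_mul]
    ring
  unfold Gnorm
  rw [h2, Real.sqrt_mul (sq_nonneg a), Real.sqrt_sq_eq_abs]

lemma Gnorm_zero {d : ℕ} (q : ℝ) (c : ℝ → Edim d) : Gnorm q c (fun _ => 0) = 0 := by
  have := Gnorm_smul q 0 c (fun _ => 0)
  simpa using this

/-- `a` and `b` are joined by a path with unit-time length bounds. -/
def Reach {d : ℕ} (q : ℝ) (a b : ℝ → Edim d) (T L : ℝ) : Prop :=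
  ∃ p : ℝ → ℝ → Edim d, (∀ θ, ContDiff ℝ 1 (fun t => p t θ)) ∧ (∀ t ≤ 0, p t = a) ∧
    (∀ t ≥ T, p t = b) ∧ (∀ t, p t ∈ Imm d) ∧ ∀ t, Gnorm q (p t) (pathVel p t) ≤ L

lemma Reach.mono {d : ℕ} {q : ℝ} {a b : ℝ → Edim d} {T L L' : ℝ} (h : Reach q a b T L)
    (hL : L ≤ L') : Reach q a b T L' := by
  obtain ⟨p, h1, h2, h3, h4, h5⟩ := h
  exact ⟨p, h1, h2, h3, h4, fun t => (h5 t).trans hL⟩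

lemma Reach.refl {d : ℕ} {q : ℝ} {a : ℝ → Edim d} (ha : a ∈ Imm d) {T L : ℝ} (hL : 0 ≤ L) :
    Reach q a a T L := by
  refine ⟨fun _ => a, fun θ => contDiff_const, fun _ _ => rfl, fun _ _ => rfl, fun _ => ha,
    fun t => ?_⟩
  unfold pathVel
  simp only [deriv_const]
  rw [Gnorm_zero]
  exact hL

lemma deriv_zero_of_const_right {E : Type*} [NormedAddCommGroup E] [NormedSpace ℝ E] {f : ℝ → E}
    (hf : Differentiable ℝ f) {T : ℝ} {b : E} (h : ∀ t ≥ T, f t = b) {t : ℝ} (ht : T ≤ t) :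
    deriv f t = 0 := by
  have h1 := (hf t).hasDerivAt.hasDerivWithinAt (s := Set.Ici t)
  have h2 : HasDerivWithinAt f 0 (Set.Ici t) t :=
    (hasDerivWithinAt_const t (Set.Ici t) b).congr (fun x hx => h x (ht.trans hx)) (h t ht)
  exact (uniqueDiffWithinAt_Ici t).eq_deriv _ h1 h2

lemma deriv_zero_of_const_left {E : Type*} [NormedAddCommGroup E] [NormedSpace ℝ E] {f : ℝ → E}
    (hf : Differentiable ℝ f) {T : ℝ} {b : E} (h : ∀ t ≤ T, f t = b) {t : ℝ} (ht : t ≤ T) :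
    deriv f t = 0 := by
  have h1 := (hf t).hasDerivAt.hasDerivWithinAt (s := Set.Iic t)
  have h2 : HasDerivWithinAt f 0 (Set.Iic t) t :=
    (hasDerivWithinAt_const t (Set.Iic t) b).congr (fun x hx => h x (le_trans hx ht)) (h t ht)
  exact (uniqueDiffWithinAt_Iic t).eq_deriv _ h1 h2

lemma Reach.trans {d : ℕ} {q : ℝ} {a b c : ℝ → Edim d} {T₁ T₂ L : ℝ} (hT₁ : 0 ≤ T₁) (hT₂ : 0 ≤ T₂)
    (h₁ : Reach q a b T₁ L) (h₂ : Reach q b c T₂ L) : Reach q a c (T₁ + T₂) L := by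
  obtain ⟨p, p1, p2, p3, p4, p5⟩ := h₁
  obtain ⟨r, r1, r2, r3, r4, r5⟩ := h₂
  set s : ℝ → ℝ → Edim d := fun t => p t + r (t - T₁) - b with hs
  have hr1 : ∀ θ, ContDiff ℝ 1 (fun t => r (t - T₁) θ) := fun θ =>
    (r1 θ).comp (contDiff_id.sub contDiff_const)
  have dp : ∀ θ, Differentiable ℝ (fun t => p t θ) := fun θ => (p1 θ).differentiable one_ne_zero
  have dr0 : ∀ θ, Differentiable ℝ (fun t => r t θ) := fun θ => (r1 θ).differentiable one_ne_zero
  have dr : ∀ θ, Differentiable ℝ (fun t => r (t - T₁) θ) :=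
    fun θ => (hr1 θ).differentiable one_ne_zero
  have vel : ∀ t θ, pathVel s t θ = pathVel p t θ + pathVel r (t - T₁) θ := by
    intro t θ
    have e1 := (dp θ t).hasDerivAt
    have e2 : HasDerivAt (fun t => r (t - T₁) θ) (pathVel r (t - T₁) θ) t :=
      HasDerivAt.comp_sub_const t T₁ (dr0 θ (t - T₁)).hasDerivAt
    exact ((e1.add e2).sub_const (b θ)).deriv
  have key1 : ∀ t ≤ T₁, s t = p t ∧ pathVel s t = pathVel p t := by
    intro t ht
    refine ⟨?_, ?_⟩
    · simp only [hs, r2 (t - T₁) (by linarith)]; abel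
    · ext1 θ
      rw [vel]
      have : pathVel r (t - T₁) θ = 0 := deriv_zero_of_const_left (dr0 θ) (T := 0) (b := b θ)
        (fun t ht => by rw [r2 t ht]) (by linarith)
      rw [this, add_zero]
  have key2 : ∀ t ≥ T₁, s t = r (t - T₁) ∧ pathVel s t = pathVel r (t - T₁) := by
    intro t ht
    refine ⟨?_, ?_⟩
    · simp only [hs, p3 t ht]; abel
    · ext1 θ
      rw [vel]
      have : pathVel p t θ = 0 := deriv_zero_of_const_right (dp θ) (T := T₁) (b := b θ)
        (fun t ht => by rw [p3 t ht]) ht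
      rw [this, zero_add]
  refine ⟨s, fun θ => ?_, fun t ht => ?_, fun t ht => ?_, fun t => ?_, fun t => ?_⟩
  · exact ((p1 θ).add (hr1 θ)).sub contDiff_const
  · rw [(key1 t (ht.trans hT₁)).1, p2 t ht]
  · rw [(key2 t (by linarith)).1, r3 _ (by linarith)]
  · rcases le_total t T₁ with h | h
    · rw [(key1 t h).1]; exact p4 t
    · rw [(key2 t h).1]; exact r4 _
  · rcases le_total t T₁ with h | h
    · rw [(key1 t h).1, (key1 t h).2]; exact p5 t
    · rw [(key2 t h).1, (key2 t h).2]; exact r5 _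

lemma Reach.chain {d : ℕ} {q : ℝ} (c : ℕ → ℝ → Edim d) {T L : ℝ} (hT : 0 ≤ T) (hL : 0 ≤ L)
    (h0 : c 0 ∈ Imm d) (n : ℕ) (h : ∀ j < n, Reach q (c j) (c (j+1)) T L) :
    Reach q (c 0) (c n) (n * T) L := by
  induction n with
  | zero => exact Reach.refl h0 hL
  | succ n ih =>
    have := (ih (fun j hj => h j (by omega))).trans (by positivity) hT (h n (by omega))
    convert this using 1
    push_cast; ring

lemma Reach.geodDist_le {d : ℕ} {q : ℝ} {a b : ℝ → Edim d} {T L : ℝ} (hT : 0 ≤ T)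
    (h : Reach q a b T L) : geodDist q (Imm d) a b ≤ ENNReal.ofReal (T * L) := by
  obtain ⟨p, p1, p2, p3, p4, p5⟩ := h
  have dp : ∀ θ, Differentiable ℝ (fun t => p t θ) := fun θ => (p1 θ).differentiable one_ne_zero
  have hlin : ContDiff ℝ 1 (fun t : ℝ => T * t) := contDiff_const.mul contDiff_id
  set s : ℝ → ℝ → Edim d := fun t => p (T * t) with hs
  have hpath : IsPathIn (Imm d) a b s := by
    refine ⟨by simp [hs, p2], by simp [hs, p3], fun t _ => p4 _, fun θ => ?_⟩
    exact ((p1 θ).comp hlin).contDiffOn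
  refine (iInf₂_le s hpath).trans ?_
  apply ENNReal.ofReal_le_ofReal
  have vel : ∀ t, pathVel s t = fun θ => T • pathVel p (T * t) θ := by
    intro t
    ext1 θ
    have e1 : HasDerivAt (fun t : ℝ => T * t) T t := by
      simpa using (hasDerivAt_id t).const_mul T
    exact (HasDerivAt.scomp t (dp θ (T * t)).hasDerivAt e1).deriv
  have hb : ∀ t ∈ Set.uIoc (0:ℝ) 1, ‖Gnorm q (s t) (pathVel s t)‖ ≤ T * L := by
    intro t _
    have hg : 0 ≤ Gnorm q (s t) (pathVel p (T * t)) := Real.sqrt_nonneg _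
    rw [vel, Gnorm_smul, abs_of_nonneg hT, Real.norm_of_nonneg (mul_nonneg hT hg)]
    gcongr
    exact p5 _
  have := intervalIntegral.norm_integral_le_of_norm_le_const hb
  rw [sub_zero, abs_one, mul_one] at this
  exact (le_abs_self _).trans this

/-! ### The travelling wave -/

/-- A bump of width `r` on the circle. -/
def bump (r z : ℝ) : ℝ := r^2 / (r^2 + Real.sin (Real.pi * z)^2)

lemma bump_den_pos {r : ℝ} (hr : 0 < r) (z : ℝ) : 0 < r^2 + Real.sin (Real.pi * z)^2 := by
  positivity

lemma bump_contDiff {r : ℝ} (hr : 0 < r) : ContDiff ℝ (⊤ : ℕ∞) (bump r) := by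
  unfold bump
  apply ContDiff.div contDiff_const
  · exact contDiff_const.add ((Real.contDiff_sin.comp (contDiff_const.mul contDiff_id)).pow 2)
  · exact fun z => (bump_den_pos hr z).ne'

lemma bump_periodic (r : ℝ) : Function.Periodic (bump r) 1 := by
  intro z
  unfold bump
  rw [mul_add, mul_one, Real.sin_add_pi, neg_sq]

lemma bump_nonneg (r z : ℝ) : 0 ≤ bump r z := by
  unfold bump; positivity

lemma bump_le_one {r : ℝ} (hr : 0 < r) (z : ℝ) : bump r z ≤ 1 := by
  unfold bump
  rw [div_le_one (bump_den_pos hr z)]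
  have := sq_nonneg (Real.sin (Real.pi * z))
  linarith

lemma int_arctan {r : ℝ} (hr : 0 < r) : ∫ z in (0:ℝ)..1, 1/(r^2 + (2*z)^2) ≤ 1/r := by
  have hd : ∀ z : ℝ, HasDerivAt (fun z => Real.arctan (2*z/r) / (2*r)) (1/(r^2+(2*z)^2)) z := by
    intro z
    have h0 : HasDerivAt (fun z : ℝ => 2*z/r) (2/r) z := by
      simpa using ((hasDerivAt_id z).const_mul 2).div_const r
    have h1 := (h0.arctan).div_const (2*r)
    have e : 1/(r^2+(2*z)^2) = 1 / (1 + (2*z/r)^2) * (2/r) / (2*r) := by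
      field_simp
    rw [e]
    exact h1
  rw [intervalIntegral.integral_eq_sub_of_hasDerivAt (fun z _ => hd z)]
  · simp only [mul_zero, zero_div, Real.arctan_zero, sub_zero]
    rw [div_le_div_iff₀ (by positivity) hr]
    have h1 := Real.arctan_lt_pi_div_two (2*1/r)
    have h2 := Real.pi_lt_four
    nlinarith
  · apply Continuous.intervalIntegrable
    apply Continuous.div continuous_const (by fun_prop)
    intro z
    positivity

lemma int_bump {r : ℝ} (hr : 0 < r) :
    ∫ z in (0:ℝ)..1, 1/(r^2 + Real.sin (Real.pi * z)^2) ≤ 2/r := by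
  have c1 : Continuous (fun z : ℝ => 1/(r^2 + (2*z)^2)) := by
    apply Continuous.div continuous_const (by fun_prop)
    intro z
    positivity
  have c2 : Continuous (fun z : ℝ => 1/(r^2 + (2*(1-z))^2)) :=
    c1.comp (continuous_const.sub continuous_id)
  calc ∫ z in (0:ℝ)..1, 1/(r^2 + Real.sin (Real.pi * z)^2)
      ≤ ∫ z in (0:ℝ)..1, (1/(r^2 + (2*z)^2) + 1/(r^2 + (2*(1-z))^2)) := by
        apply intervalIntegral.integral_mono_on zero_le_one
        · apply Continuous.intervalIntegrable
          apply Continuous.div continuous_const (by fun_prop)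
          exact fun z => (bump_den_pos hr z).ne'
        · exact (c1.add c2).intervalIntegrable _ _
        · intro z hz
          have hpi := Real.pi_pos
          rcases le_total z (1/2) with h | h
          · have h1 : 2 * z ≤ Real.sin (Real.pi * z) := by
              have := Real.mul_le_sin (x := Real.pi * z) (mul_nonneg hpi.le hz.1) (by nlinarith)
              have e : 2 / Real.pi * (Real.pi * z) = 2 * z := by field_simp
              rwa [e] at this
            have h2 : 1/(r^2 + Real.sin (Real.pi * z)^2) ≤ 1/(r^2 + (2*z)^2) := by
              have := hz.1
              gcongr
            have : 0 ≤ 1/(r^2 + (2*(1-z))^2) := by positivity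
            linarith
          · have h1 : 2 * (1-z) ≤ Real.sin (Real.pi * z) := by
              have hz1 := hz.2
              have := Real.mul_le_sin (x := Real.pi * (1-z)) (mul_nonneg hpi.le (by linarith))
                (by nlinarith)
              have e : 2 / Real.pi * (Real.pi * (1-z)) = 2 * (1-z) := by field_simp
              rw [e] at this
              have e2 : Real.pi * (1-z) = Real.pi - Real.pi * z := by ring
              rwa [e2, Real.sin_pi_sub] at this
            have h2 : 1/(r^2 + Real.sin (Real.pi * z)^2) ≤ 1/(r^2 + (2*(1-z))^2) := by
              have h3 : 0 ≤ 2 * (1-z) := by linarith [hz.2]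
              gcongr
            have : 0 ≤ 1/(r^2 + (2*z)^2) := by positivity
            linarith
    _ = (∫ z in (0:ℝ)..1, 1/(r^2 + (2*z)^2)) + ∫ z in (0:ℝ)..1, 1/(r^2 + (2*z)^2) := by
        rw [intervalIntegral.integral_add (c1.intervalIntegrable _ _) (c2.intervalIntegrable _ _)]
        congr 1
        have := intervalIntegral.integral_comp_sub_left (a := 0) (b := 1)
          (fun z : ℝ => 1/(r^2 + (2*z)^2)) 1
        simpa using this
    _ ≤ 1/r + 1/r := add_le_add (int_arctan hr) (int_arctan hr)
    _ = 2/r := by ring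

lemma int_bump_sq {r : ℝ} (hr : 0 < r) : ∫ z in (0:ℝ)..1, bump r z ^ 2 ≤ 2*r := by
  have hc := (bump_contDiff hr).continuous
  calc ∫ z in (0:ℝ)..1, bump r z ^ 2
      ≤ ∫ z in (0:ℝ)..1, r^2 * (1/(r^2 + Real.sin (Real.pi * z)^2)) := by
        apply intervalIntegral.integral_mono_on zero_le_one
        · exact (hc.pow 2).intervalIntegrable _ _
        · apply Continuous.intervalIntegrable
          apply Continuous.mul continuous_const
          apply Continuous.div continuous_const (by fun_prop)
          exact fun z => (bump_den_pos hr z).ne'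
        · intro z _
          have h0 := bump_nonneg r z
          have h1 := bump_le_one hr z
          have : bump r z = r^2 * (1/(r^2 + Real.sin (Real.pi * z)^2)) := by
            unfold bump; ring
          rw [← this]
          nlinarith
    _ ≤ r^2 * (2/r) := by
        rw [intervalIntegral.integral_const_mul]
        gcongr
        exact int_bump hr
    _ = 2*r := by field_simp

lemma bump_deriv {r : ℝ} (hr : 0 < r) (z : ℝ) : deriv (bump r) z ^ 2 ≤
    40 * (1/(r^2 + Real.sin (Real.pi * z)^2)) := by
  have hD := bump_den_pos hr z
  have h0 : HasDerivAt (fun z : ℝ => Real.pi * z) Real.pi z := by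
    simpa using (hasDerivAt_id z).const_mul Real.pi
  have h1 : HasDerivAt (fun z : ℝ => r^2 + Real.sin (Real.pi * z)^2)
      (2 * Real.sin (Real.pi * z) * (Real.cos (Real.pi * z) * Real.pi)) z := by
    have := ((h0.sin).pow 2).const_add (r^2)
    simpa using this
  have h2 := (h1.inv hD.ne').const_mul (r^2)
  have h3 : deriv (bump r) z = r^2 * (-(2 * Real.sin (Real.pi * z) *
      (Real.cos (Real.pi * z) * Real.pi)) / (r^2 + Real.sin (Real.pi * z)^2)^2) := h2.deriv
  rw [h3]
  set s := Real.sin (Real.pi * z)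
  set c := Real.cos (Real.pi * z)
  have hc : c^2 ≤ 1 := by
    have : s^2 + c^2 = 1 := Real.sin_sq_add_cos_sq _
    nlinarith [sq_nonneg s]
  have hp : Real.pi^2 ≤ 10 := by nlinarith [Real.pi_lt_d2, Real.pi_pos]
  have e : (r^2 * (-(2 * s * (c * Real.pi)) / (r^2 + s^2)^2))^2
      = (4 * Real.pi^2 * c^2) * ((r^2)^2 * s^2) / (r^2+s^2)^4 := by
    field_simp
    ring
  rw [e, mul_one_div, div_le_div_iff₀ (by positivity) hD]
  have i1 : (r^2)^2 * s^2 ≤ (r^2+s^2)^2 * (r^2+s^2) := by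
    gcongr
    · have := sq_nonneg s; linarith
    · have := sq_nonneg r; linarith
  have i2 : 4 * Real.pi^2 * c^2 ≤ 40 := by nlinarith [sq_nonneg c, sq_nonneg Real.pi]
  calc (4 * Real.pi^2 * c^2) * ((r^2)^2 * s^2) * (r^2+s^2)
      ≤ 40 * ((r^2+s^2)^2 * (r^2+s^2)) * (r^2+s^2) := by gcongr
    _ = 40 * (r^2+s^2)^4 := by ring

lemma int_bump_deriv_sq {r : ℝ} (hr : 0 < r) :
    ∫ z in (0:ℝ)..1, deriv (bump r) z ^ 2 ≤ 80/r := by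
  have hc : Continuous (deriv (bump r)) := (bump_contDiff hr).continuous_deriv (by simp)
  calc ∫ z in (0:ℝ)..1, deriv (bump r) z ^ 2
      ≤ ∫ z in (0:ℝ)..1, 40 * (1/(r^2 + Real.sin (Real.pi * z)^2)) := by
        apply intervalIntegral.integral_mono_on zero_le_one
        · exact (hc.pow 2).intervalIntegrable _ _
        · apply Continuous.intervalIntegrable
          apply Continuous.mul continuous_const
          apply Continuous.div continuous_const (by fun_prop)
          exact fun z => (bump_den_pos hr z).ne'
        · intro z _
          exact bump_deriv hr z
    _ ≤ 40 * (2/r) := by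
        rw [intervalIntegral.integral_const_mul]
        gcongr
        exact int_bump hr
    _ = 80/r := by ring

lemma bump_lower {r : ℝ} (hr : 0 < r) (z : ℝ) : 1 - (Real.pi/r)^2 * z^2 ≤ bump r z := by
  have hD := bump_den_pos hr z
  unfold bump
  rw [le_div_iff₀ hD]
  have h1 : Real.sin (Real.pi * z)^2 ≤ (Real.pi * z)^2 := by
    rw [sq_le_sq]; exact Real.abs_sin_le_abs
  have h2 : (Real.pi/r)^2 * z^2 * r^2 = (Real.pi * z)^2 := by field_simp
  have h3 : 0 ≤ (Real.pi/r)^2 * z^2 * Real.sin (Real.pi * z)^2 := by positivity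
  nlinarith

/-- Intermediate value theorem for the travelling time. -/
lemma exists_theta (W : ℝ → ℝ) (hW : Continuous W) (h0 : ∀ z, 0 ≤ W z) (h1 : ∀ z, W z ≤ 1)
    (K : ℝ) (hK : 0 ≤ K) (hWK : ∀ z, 1 - K * z^2 ≤ W z) (T : ℝ) (hT : 1 ≤ T) :
    ∃ θ : ℝ, 0 ≤ θ ∧ θ < 1 ∧ ∫ z in (0:ℝ)..1, 1/(1 - θ * W z) = T := by
  set η := 1/((1+K)*T) with hη
  have hT0 : 0 < T := by linarith
  have hηpos : 0 < η := by positivity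
  have hη1 : η ≤ 1 := by
    rw [hη, div_le_one (by positivity)]
    nlinarith
  set θ₁ := 1 - η^2 with hθ₁
  have hθ0 : 0 ≤ θ₁ := by nlinarith
  have hθ1 : θ₁ < 1 := by nlinarith
  have hη2 : 0 < η^2 := by positivity
  have hden : ∀ θ, θ ∈ Set.Icc 0 θ₁ → ∀ z, η^2 ≤ 1 - θ * W z := by
    intro θ hθ z
    have : θ * W z ≤ θ₁ * 1 := by
      gcongr
      · exact h0 z
      · exact hθ.2
      · exact h1 z
    linarith
  set F : ℝ → ℝ := fun θ => ∫ z in (0:ℝ)..1, 1/(max (η^2) (1 - θ * W z)) with hF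
  have hFc : Continuous F := by
    apply intervalIntegral.continuous_parametric_intervalIntegral_of_continuous'
    apply Continuous.div continuous_const
    · apply Continuous.max continuous_const
      exact continuous_const.sub (continuous_fst.mul (hW.comp continuous_snd))
    · intro x
      exact (lt_of_lt_of_le hη2 (le_max_left _ _)).ne'
  have hFe : ∀ θ ∈ Set.Icc 0 θ₁, F θ = ∫ z in (0:ℝ)..1, 1/(1 - θ * W z) := by
    intro θ hθ
    simp only [hF]
    congr 1
    ext z
    rw [max_eq_right (hden θ hθ z)]
  have hF0 : F 0 = 1 := by
    rw [hFe 0 ⟨le_rfl, hθ0⟩]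
    simp
  have hF1 : T ≤ F θ₁ := by
    have hpos : ∀ z, 0 < 1 - θ₁ * W z := fun z => lt_of_lt_of_le hη2 (hden θ₁ ⟨hθ0, le_rfl⟩ z)
    have hc : Continuous (fun z => 1/(1 - θ₁ * W z)) := by
      apply Continuous.div continuous_const
      · exact continuous_const.sub (continuous_const.mul hW)
      · exact fun z => (hpos z).ne'
    rw [hFe θ₁ ⟨hθ0, le_rfl⟩]
    rw [← intervalIntegral.integral_add_adjacent_intervals (hc.intervalIntegrable 0 η)
      (hc.intervalIntegrable η 1)]
    have i2 : 0 ≤ ∫ z in η..1, 1/(1 - θ₁ * W z) :=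
      intervalIntegral.integral_nonneg hη1 (fun z _ => (div_pos one_pos (hpos z)).le)
    have i1 : ∫ z in (0:ℝ)..η, 1/((1+K)*η^2) ≤ ∫ z in (0:ℝ)..η, 1/(1 - θ₁ * W z) := by
      apply intervalIntegral.integral_mono_on hηpos.le (by simp) (hc.intervalIntegrable _ _)
      intro z hz
      apply one_div_le_one_div_of_le (hpos z)
      have hz2 : z^2 ≤ η^2 := by
        have := hz.1
        have := hz.2
        gcongr
      have hkz : K * z^2 ≤ K * η^2 := by gcongr
      have hk0 : 0 ≤ K * η^2 := by positivity
      have hw := hWK z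
      have hw' : 1 - K * η^2 ≤ W z := by linarith
      nlinarith [mul_nonneg hη2.le hk0]
    rw [intervalIntegral.integral_const, smul_eq_mul, sub_zero] at i1
    have e : η * (1/((1+K)*η^2)) = T := by
      have : (1+K) * η = 1/T := by rw [hη]; field_simp
      have e2 : (1+K)*η^2 = (1/T) * η := by rw [← this]; ring
      rw [e2]
      field_simp
    linarith
  obtain ⟨θ, hθ, hθT⟩ := intermediate_value_Icc hθ0 hFc.continuousOn (show T ∈ Set.Icc (F 0) (F θ₁)
    from ⟨by rw [hF0]; exact hT, hF1⟩)
  exact ⟨θ, hθ.1, lt_of_le_of_lt hθ.2 hθ1, by rw [← hFe θ hθ, hθT]⟩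

/-- The travelling wave flow. -/
lemma wave (w : ℝ → ℝ) (hw : ContDiff ℝ (⊤ : ℕ∞) w) (hp : Function.Periodic w 1)
    (h1 : ∀ z, w z < 1) (T : ℝ) (hT : 0 < T)
    (hint : ∫ z in (0:ℝ)..1, 1/(1 - w z) = T) :
    ∃ Φ : ℝ → ℝ → ℝ, (∀ t, IsCircleDiffeo (Φ t)) ∧ (∀ x, Φ 0 x = x) ∧ (∀ x, Φ T x = x + (T - 1)) ∧
      (∀ t x, HasDerivAt (fun s => Φ s x) (w (Φ t x - t)) t) ∧
      (∀ x, ContDiff ℝ (⊤ : ℕ∞) (fun t => Φ t x)) := by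
  have hpos : ∀ z, 0 < 1 - w z := fun z => by linarith [h1 z]
  have hsm : ContDiff ℝ (⊤ : ℕ∞) (fun z => 1/(1 - w z)) :=
    contDiff_const.div (contDiff_const.sub hw) (fun z => (hpos z).ne')
  have hc := hsm.continuous
  set P : ℝ → ℝ := fun x => ∫ z in (0:ℝ)..x, 1/(1 - w z) with hP
  have hPd : ∀ x, HasDerivAt P (1/(1 - w x)) x := fun x =>
    intervalIntegral.integral_hasDerivAt_right (hc.intervalIntegrable _ _)
    (hc.stronglyMeasurableAtFilter _ _) hc.continuousAt
  have hPd' : deriv P = fun x => 1/(1 - w x) := funext fun x => (hPd x).deriv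
  have hPs : ContDiff ℝ (⊤ : ℕ∞) P := by
    rw [contDiff_infty_iff_deriv]
    refine ⟨fun x => (hPd x).differentiableAt, ?_⟩
    rw [hPd']
    exact hsm
  have hPT : ∀ x, P (x+1) = P x + T := by
    intro x
    have hper : Function.Periodic (fun z => 1/(1 - w z)) 1 := fun z => by simp only [hp z]
    have e1 := hper.intervalIntegral_add_eq x 0
    have e2 := intervalIntegral.integral_add_adjacent_intervals
      (hc.intervalIntegrable (μ := volume) 0 x) (hc.intervalIntegrable x (x+1))
    simp only [hP]
    rw [← e2, e1, zero_add, hint]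
  have hPpos : ∀ x, 0 < deriv P x := fun x => by
    rw [hPd']; exact one_div_pos.2 (hpos x)
  obtain ⟨Q, q1, q2, q3, q4, q5, q6⟩ := exists_inverse P T hT hPs hPT hPpos
  have hQ' : ∀ y, HasDerivAt Q (1 - w (Q y)) y := by
    intro y
    have := q5 y
    rw [hPd'] at this
    simpa using this
  refine ⟨fun t x => t + Q (P x - t), fun t => ⟨?_, fun x => ?_, fun x => ?_⟩, fun x => ?_,
    fun x => ?_, fun t x => ?_, fun x => ?_⟩
  · exact contDiff_const.add (q1.comp (hPs.sub contDiff_const))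
  · change t + Q (P (x+1) - t) = t + Q (P x - t) + 1
    rw [hPT, add_sub_right_comm, q4, add_assoc]
  · have := ((HasDerivAt.comp x (hQ' (P x - t)) ((hPd x).sub_const t))).const_add t
    have e : deriv (fun x => t + Q (P x - t)) x = _ := this.deriv
    rw [e]
    exact mul_pos (hpos _) (one_div_pos.2 (hpos x))
  · simp [q2]
  · change T + Q (P x - T) = x + (T - 1)
    have := q4 (P x - T)
    rw [sub_add_cancel, q2] at this
    linarith
  · have e0 : HasDerivAt (fun s : ℝ => P x - s) (-1) t := by
      simpa using (hasDerivAt_id t).const_sub (P x)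
    have := (hasDerivAt_id t).add (HasDerivAt.comp t (hQ' (P x - t)) e0)
    have e2 : w (t + Q (P x - t) - t) = 1 + (1 - w (Q (P x - t))) * (-1) := by
      rw [add_sub_cancel_left]; ring
    rw [e2]
    exact this
  · exact contDiff_id.add (q1.comp (contDiff_const.sub contDiff_id))

lemma step_bound : ∃ M : ℝ, 0 < M ∧ ∀ τ, |deriv Real.smoothTransition τ| ≤ M := by
  have hs : ContDiff ℝ (⊤ : ℕ∞) Real.smoothTransition := Real.smoothTransition.contDiff
  have hc : Continuous (deriv Real.smoothTransition) := hs.continuous_deriv (by simp)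
  obtain ⟨M, hM⟩ := isCompact_Icc.exists_bound_of_continuousOn (s := Set.Icc (0:ℝ) 1)
    hc.continuousOn
  have hd : Differentiable ℝ Real.smoothTransition := hs.differentiable (by simp)
  refine ⟨max M 1, by positivity, fun τ => ?_⟩
  rcases le_total τ 0 with h | h
  · rw [deriv_zero_of_const_left hd (T := 0) (b := 0)
      (fun t ht => Real.smoothTransition.zero_of_nonpos ht) h, abs_zero]
    positivity
  rcases le_total 1 τ with h' | h'
  · rw [deriv_zero_of_const_right hd (T := 1) (b := 1)
      (fun t ht => Real.smoothTransition.one_of_one_le ht) h', abs_zero]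
    positivity
  · exact (hM τ ⟨h, h'⟩).trans (le_max_left _ _)

/-! ### Cheap rotations and short linear paths -/

/-- The averaged multi-scale profile. -/
lemma exists_profile (N : ℕ) (hN : 0 < N) (T : ℝ) (hT : 1 ≤ T) :
    ∃ θ : ℝ, 0 ≤ θ ∧ θ < 1 ∧
      (∀ z, ∑ k ∈ Finset.range N, θ/N * bump ((1/4)^k) z < 1) ∧
      ∫ z in (0:ℝ)..1, 1/(1 - ∑ k ∈ Finset.range N, θ/N * bump ((1/4)^k) z) = T := by
  have hr : ∀ k : ℕ, (0:ℝ) < (1/4)^k := fun k => by positivity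
  have hN' : (0:ℝ) < N := by exact_mod_cast hN
  set W : ℝ → ℝ := fun z => (1/N) * ∑ k ∈ Finset.range N, bump ((1/4)^k) z with hW
  have hWc : Continuous W := by
    apply Continuous.mul continuous_const
    exact continuous_finsetSum _ (fun k _ => (bump_contDiff (hr k)).continuous)
  have h0 : ∀ z, 0 ≤ W z := fun z =>
    mul_nonneg (by positivity) (Finset.sum_nonneg fun k _ => bump_nonneg _ _)
  have h1 : ∀ z, W z ≤ 1 := by
    intro z
    have : ∑ k ∈ Finset.range N, bump ((1/4)^k) z ≤ ∑ k ∈ Finset.range N, (1:ℝ) :=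
      Finset.sum_le_sum fun k _ => bump_le_one (hr k) z
    simp only [Finset.sum_const, Finset.card_range, nsmul_eq_mul, mul_one] at this
    calc W z ≤ (1/N) * N := by simp only [hW]; gcongr
      _ = 1 := by field_simp
  set K : ℝ := ∑ k ∈ Finset.range N, (Real.pi/(1/4)^k)^2 with hK
  have hWK : ∀ z, 1 - K * z^2 ≤ W z := by
    intro z
    have : ∑ k ∈ Finset.range N, (1 - K * z^2) ≤ ∑ k ∈ Finset.range N, bump ((1/4)^k) z := by
      refine Finset.sum_le_sum fun k hk => ?_
      refine le_trans ?_ (bump_lower (hr k) z)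
      have : (Real.pi/(1/4)^k)^2 ≤ K :=
        Finset.single_le_sum (f := fun k : ℕ => (Real.pi/(1/4:ℝ)^k)^2)
          (fun _ _ => by positivity) hk
      have hz : 0 ≤ z^2 := by positivity
      nlinarith
    simp only [Finset.sum_const, Finset.card_range, nsmul_eq_mul] at this
    calc 1 - K * z^2 = (1/N) * (N * (1 - K * z^2)) := by field_simp
      _ ≤ _ := by simp only [hW]; gcongr
  obtain ⟨θ, t0, t1, t2⟩ := exists_theta W hWc h0 h1 K
    (Finset.sum_nonneg fun _ _ => by positivity) hWK T hT
  have e : ∀ z, ∑ k ∈ Finset.range N, θ/N * bump ((1/4)^k) z = θ * W z := by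
    intro z
    rw [← Finset.mul_sum]
    simp only [hW]
    ring
  refine ⟨θ, t0, t1, fun z => ?_, ?_⟩
  · rw [e]
    have := mul_le_mul_of_nonneg_left (h1 z) t0
    linarith
  · simp only [e]
    exact t2

lemma reach_rotate {d : ℕ} (q : ℝ) (hq0 : 0 ≤ q) (hq : q ≤ 1/2) (γ : ℝ → Edim d) (hγ : γ ∈ Imm d)
    (Θ : ℝ → ℝ) (hΘ : IsCircleDiffeo Θ) (α : ℝ) (hα : 0 < α) (δ : ℝ) (hδ : 0 < δ) :
    Reach q (γ ∘ Θ) (fun x => γ (Θ x + α)) 1 δ := by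
  obtain ⟨C, hC, henergy⟩ := energy q hq0 hq γ hγ
  obtain ⟨M, hM, hMb⟩ := step_bound
  set T := 1 + α with hT
  have hTpos : 0 < T := by linarith
  set X := (C * (T * M))^2 * 80 / δ^2 with hX
  obtain ⟨N, hN⟩ := exists_nat_gt (max X 1)
  have hN1 : (1:ℝ) < N := lt_of_le_of_lt (le_max_right _ _) hN
  have hNX : X < N := lt_of_le_of_lt (le_max_left _ _) hN
  have hNpos : (0:ℝ) < N := by linarith
  have hN0 : 0 < N := by exact_mod_cast hNpos
  obtain ⟨θ, t0, t1, t2, t3⟩ := exists_profile N hN0 T (by linarith)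
  have hr : ∀ k : ℕ, (0:ℝ) < (1/4)^k := fun k => by positivity
  set w : ℝ → ℝ := fun z => ∑ k ∈ Finset.range N, θ/N * bump ((1/4)^k) z with hw
  have hwsm : ContDiff ℝ (⊤ : ℕ∞) w :=
    ContDiff.sum (fun k _ => contDiff_const.mul (bump_contDiff (hr k)))
  have hwp : Function.Periodic w 1 := by
    intro z
    simp only [hw]
    refine Finset.sum_congr rfl fun k _ => ?_
    rw [bump_periodic _ z]
  obtain ⟨Φ, f1, f2, f3, f4, f5⟩ := wave w hwsm hwp t2 T hTpos t3
  set s : ℝ → ℝ := Real.smoothTransition with hs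
  have hss : ContDiff ℝ (⊤ : ℕ∞) s := Real.smoothTransition.contDiff
  have hsd : Differentiable ℝ s := hss.differentiable (by simp)
  have hTs : ∀ τ, HasDerivAt (fun τ => T * s τ) (T * deriv s τ) τ := fun τ =>
    (hsd τ).hasDerivAt.const_mul T
  refine ⟨fun τ x => γ (Φ (T * s τ) (Θ x)), fun x => ?_, fun τ hτ => ?_, fun τ hτ => ?_,
    fun τ => ?_, fun τ => ?_⟩
  · have : ContDiff ℝ (⊤ : ℕ∞) (fun τ => γ (Φ (T * s τ) (Θ x))) :=
      hγ.2.1.comp ((f5 (Θ x)).comp (contDiff_const.mul hss))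
    exact this.of_le (by simp)
  · ext1 x
    have : s τ = 0 := Real.smoothTransition.zero_of_nonpos hτ
    simp only [this, mul_zero, f2, Function.comp]
  · ext1 x
    have : s τ = 1 := Real.smoothTransition.one_of_one_le hτ
    simp only [this, mul_one, f3]
    congr 1
    rw [hT]; ring
  · exact Imm.comp hγ ((f1 (T * s τ)).comp hΘ)
  · set t := T * s τ with ht
    set a := T * deriv s τ * (θ/N) with ha
    set U : ℕ → ℝ → ℝ := fun k y => a * bump ((1/4)^k) (y - t) with hU
    have hUd : ∀ k y, deriv (U k) y = a * deriv (bump ((1/4)^k)) (y - t) := by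
      intro k y
      simp only [hU]
      rw [deriv_const_mul_field, deriv_comp_sub_const]
    have hΨ := (f1 t).comp hΘ
    have hvel : pathVel (fun τ x => γ (Φ (T * s τ) (Θ x))) τ =
        fun x => (∑ k ∈ Finset.range N, U k ((Φ t ∘ Θ) x)) • deriv γ ((Φ t ∘ Θ) x) := by
      ext1 x
      have e1 := HasDerivAt.comp τ (f4 t (Θ x)) (hTs τ)
      have e2 := HasDerivAt.scomp τ (Imm.differentiable hγ (Φ t (Θ x))).hasDerivAt e1
      have e3 : pathVel (fun τ x => γ (Φ (T * s τ) (Θ x))) τ x = _ := e2.deriv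
      rw [e3]
      simp only [Function.comp]
      congr 1
      simp only [hU, hw, Finset.sum_mul]
      refine Finset.sum_congr rfl fun k _ => ?_
      rw [ha]; ring
    have hshift : ∀ g : ℝ → ℝ, Function.Periodic g 1 →
        ∫ x in (0:ℝ)..1, g (x - t) = ∫ x in (0:ℝ)..1, g x := by
      intro g hg
      rw [intervalIntegral.integral_comp_sub_right]
      have := hg.intervalIntegral_add_eq (0 - t) 0
      rw [zero_add] at this
      rw [← this]
      congr 1
      ring
    have hbp : ∀ k : ℕ, Function.Periodic (fun x => bump ((1/4)^k) x ^ 2) 1 := fun k x => by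
      simp only [bump_periodic _ x]
    have hbp' : ∀ k : ℕ, Function.Periodic (fun x => deriv (bump ((1/4)^k)) x ^ 2) 1 :=
      fun k x => by
        simp only [periodic_deriv _ (bump_periodic _) x]
    have key := henergy (Φ t ∘ Θ) hΨ N U (80 * a^2)
      (fun k _ => by
        have : ContDiff ℝ (⊤ : ℕ∞) (U k) :=
          contDiff_const.mul ((bump_contDiff (hr k)).comp (contDiff_id.sub contDiff_const))
        exact this.of_le (by simp))
      (fun k _ y => by
        simp only [hU]
        rw [add_sub_right_comm, bump_periodic _ (y - t)])
      (fun k _ => by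
        simp only [hU, mul_pow]
        rw [intervalIntegral.integral_const_mul, hshift _ (hbp k)]
        have := int_bump_sq (hr k)
        have ha2 := sq_nonneg a
        have h4 := hr k
        calc a^2 * _ ≤ a^2 * (2 * (1/4)^k) := by gcongr
          _ ≤ 80 * a^2 * (1/4)^k := by nlinarith [mul_nonneg ha2 h4.le])
      (fun k _ => by
        simp only [hUd, mul_pow]
        rw [intervalIntegral.integral_const_mul, hshift _ (hbp' k)]
        have := int_bump_deriv_sq (hr k)
        calc a^2 * _ ≤ a^2 * (80 / (1/4)^k) := by gcongr
          _ = 80 * a^2 * 4^k := by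
            rw [one_div, inv_pow, div_inv_eq_mul]; ring)
    change Gnorm q (γ ∘ (Φ t ∘ Θ)) _ ≤ δ
    rw [hvel]
    refine key.trans ?_
    have hab : |a| ≤ T * M / N := by
      rw [ha, abs_mul, abs_mul, abs_of_pos hTpos, abs_of_nonneg (div_nonneg t0 hNpos.le)]
      calc T * |deriv s τ| * (θ/N) ≤ T * M * (1/N) := by
            gcongr
            exact hMb τ
        _ = _ := by ring
    have ha2 : a^2 ≤ (T*M/N)^2 := by
      rw [← sq_abs]; gcongr
    have : (N:ℝ) * (80 * a^2) ≤ (δ/C)^2 := by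
      calc (N:ℝ) * (80 * a^2) ≤ N * (80 * (T*M/N)^2) := by gcongr
        _ = 80 * (T*M)^2 / N := by field_simp
        _ ≤ (δ/C)^2 := by
          rw [div_le_iff₀ hNpos]
          have h1 : (δ/C)^2 * X = 80 * (T*M)^2 := by rw [hX]; field_simp
          rw [← h1]
          gcongr
    calc C * √(N * (80 * a^2)) ≤ C * (δ/C) := by
          gcongr
          rw [Real.sqrt_le_left (by positivity)]
          exact this
      _ = δ := by field_simp

/-- Short linear paths of reparametrizations. -/
lemma reach_linear {d : ℕ} (q : ℝ) (hq0 : 0 ≤ q) (hq : q ≤ 1/2) (γ : ℝ → Edim d) (hγ : γ ∈ Imm d)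
    (m : ℝ) (hm : 0 < m) : ∃ C : ℝ, 0 < C ∧ ∀ A B : ℝ → ℝ, IsCircleDiffeo A → IsCircleDiffeo B →
      (∀ x, m ≤ deriv A x) → (∀ x, m ≤ deriv B x) → ∀ η : ℝ, 0 ≤ η →
      (∀ x, |B x - A x| ≤ η) → (∀ x, |deriv B x - deriv A x| ≤ η) →
      Reach q (γ ∘ A) (γ ∘ B) 1 (C * η) := by
  obtain ⟨C, hC, henergy⟩ := energy q hq0 hq γ hγ
  obtain ⟨M, hM, hMb⟩ := step_bound
  refine ⟨C * (M * (1 + m⁻¹)), by positivity, ?_⟩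
  intro A B hA hB hAm hBm η hη h0 h1
  set s : ℝ → ℝ := Real.smoothTransition with hs
  have hss : ContDiff ℝ (⊤ : ℕ∞) s := Real.smoothTransition.contDiff
  have hsd : Differentiable ℝ s := hss.differentiable (by simp)
  set Ψ : ℝ → ℝ → ℝ := fun τ x => A x + s τ * (B x - A x) with hΨ
  have hΨd : ∀ τ x, HasDerivAt (Ψ τ) (deriv A x + s τ * (deriv B x - deriv A x)) x := fun τ x =>
    (hA.differentiable x).hasDerivAt.add
      (((hB.differentiable x).hasDerivAt.sub (hA.differentiable x).hasDerivAt).const_mul (s τ))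
  have hΨm : ∀ τ x, m ≤ deriv (Ψ τ) x := by
    intro τ x
    rw [(hΨd τ x).deriv]
    have s0 : 0 ≤ s τ := Real.smoothTransition.nonneg τ
    have s1 : s τ ≤ 1 := Real.smoothTransition.le_one τ
    have := hAm x
    have := hBm x
    nlinarith [mul_nonneg s0 (sub_nonneg.2 (hBm x)),
      mul_nonneg (sub_nonneg.2 s1) (sub_nonneg.2 (hAm x))]
  have hΨc : ∀ τ, IsCircleDiffeo (Ψ τ) := by
    intro τ
    refine ⟨hA.1.add (contDiff_const.mul (hB.1.sub hA.1)), fun x => ?_, fun x => ?_⟩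
    · simp only [hΨ, hA.2.1, hB.2.1]; ring
    · exact lt_of_lt_of_le hm (hΨm τ x)
  refine ⟨fun τ x => γ (Ψ τ x), fun x => ?_, fun τ hτ => ?_, fun τ hτ => ?_,
    fun τ => ?_, fun τ => ?_⟩
  · have : ContDiff ℝ (⊤ : ℕ∞) (fun τ => γ (Ψ τ x)) :=
      hγ.2.1.comp (contDiff_const.add (hss.mul contDiff_const))
    exact this.of_le (by simp)
  · ext1 x
    have : s τ = 0 := Real.smoothTransition.zero_of_nonpos hτ
    simp only [hΨ, this, zero_mul, add_zero, Function.comp]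
  · ext1 x
    have : s τ = 1 := Real.smoothTransition.one_of_one_le hτ
    simp only [hΨ, this, one_mul, add_sub_cancel, Function.comp]
  · exact Imm.comp hγ (hΨc τ)
  · obtain ⟨Q, hQ, Q1, Q2, Q3, -⟩ := (hΨc τ).exists_inv
    set a := deriv s τ with ha
    have hab : |a| ≤ M := hMb τ
    set U : ℕ → ℝ → ℝ := fun _ y => a * (B (Q y) - A (Q y)) with hU
    have hUd : ∀ k y, deriv (U k) y =
        a * ((deriv B (Q y) - deriv A (Q y)) * (deriv (Ψ τ) (Q y))⁻¹) := by
      intro k y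
      have := (HasDerivAt.comp y ((hB.differentiable (Q y)).hasDerivAt.sub
        (hA.differentiable (Q y)).hasDerivAt) (Q3 y)).const_mul a
      exact this.deriv
    have hUs : ∀ k, ContDiff ℝ (⊤ : ℕ∞) (U k) := fun k =>
      contDiff_const.mul ((hB.1.comp hQ.1).sub (hA.1.comp hQ.1))
    have hvel : pathVel (fun τ x => γ (Ψ τ x)) τ =
        fun x => (∑ k ∈ Finset.range 1, U k (Ψ τ x)) • deriv γ (Ψ τ x) := by
      ext1 x
      have e1 : HasDerivAt (fun τ => Ψ τ x) (a * (B x - A x)) τ :=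
        ((hsd τ).hasDerivAt.mul_const (B x - A x)).const_add (A x)
      have e2 := HasDerivAt.scomp τ (Imm.differentiable hγ (Ψ τ x)).hasDerivAt e1
      have e3 : pathVel (fun τ x => γ (Ψ τ x)) τ x = _ := e2.deriv
      rw [e3]
      simp only [Finset.sum_range_one, hU, Q1]
    set V := M * (1 + m⁻¹) * η with hV
    have hV0 : 0 ≤ V := by positivity
    have hMm : M ≤ M * (1 + m⁻¹) := by
      have : 0 < M * m⁻¹ := by positivity
      nlinarith
    have b0 : ∀ x, U 0 x ^ 2 ≤ V^2 := by
      intro x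
      rw [sq_le_sq, abs_of_nonneg hV0]
      simp only [hU, abs_mul]
      calc |a| * |B (Q x) - A (Q x)| ≤ M * η := by
            gcongr
            exact h0 _
        _ ≤ V := by rw [hV]; gcongr
    have b1 : ∀ x, deriv (U 0) x ^ 2 ≤ V^2 := by
      intro x
      rw [sq_le_sq, abs_of_nonneg hV0, hUd 0, abs_mul, abs_mul]
      have hd := hΨm τ (Q x)
      have hdp : 0 < deriv (Ψ τ) (Q x) := lt_of_lt_of_le hm hd
      rw [abs_of_pos (inv_pos.2 hdp)]
      calc |a| * (|deriv B (Q x) - deriv A (Q x)| * (deriv (Ψ τ) (Q x))⁻¹)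
          ≤ M * (η * m⁻¹) := by
            gcongr
            exact h1 _
        _ ≤ V := by
            rw [hV]
            have : 0 ≤ M * η := by positivity
            nlinarith
    have cb : ∀ f : ℝ → ℝ, Continuous f → (∀ x, f x ≤ V^2) → ∫ x in (0:ℝ)..1, f x ≤ V^2 := by
      intro f hf hfb
      have := intervalIntegral.integral_mono_on zero_le_one (hf.intervalIntegrable (μ := volume) 0 1)
        (intervalIntegrable_const (c := V^2)) (fun x _ => hfb x)
      simpa using this
    have key := henergy (Ψ τ) (hΨc τ) 1 U (V^2)
      (fun k _ => (hUs k).of_le (by simp))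
      (fun k _ y => by
        simp only [hU, hQ.2.1, hA.2.1, hB.2.1]; ring)
      (fun k hk => by
        obtain rfl : k = 0 := by omega
        rw [pow_zero, mul_one]
        exact cb _ ((hUs 0).continuous.pow 2) b0)
      (fun k hk => by
        obtain rfl : k = 0 := by omega
        rw [pow_zero, mul_one]
        exact cb _ (((hUs 0).continuous_deriv (by simp)).pow 2) b1)
    rw [hvel]
    refine key.trans ?_
    rw [Nat.cast_one, one_mul, Real.sqrt_sq hV0, hV]
    apply le_of_eq
    ring

/-! ### One step of the flow -/

lemma taylor_two (f f' f'' : ℝ → ℝ) (G ε : ℝ) (hε : 0 ≤ ε) (h1 : ∀ u, HasDerivAt f (f' u) u)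
    (h2 : ∀ u, HasDerivAt f' (f'' u) u) (hG : ∀ u, |f'' u| ≤ G) :
    |f ε - f 0 - ε * f' 0| ≤ G * ε^2 := by
  have hG0 : 0 ≤ G := (abs_nonneg _).trans (hG 0)
  have a1 : ∀ u ∈ Set.Icc (0:ℝ) ε, |f' u - f' 0| ≤ G * ε := by
    intro u hu
    have := (convex_univ (𝕜 := ℝ) (E := ℝ)).norm_image_sub_le_of_norm_hasDerivWithin_le
      (f := f') (f' := f'') (C := G) (fun x _ => (h2 x).hasDerivWithinAt) (fun x _ => hG x)
      (Set.mem_univ 0) (Set.mem_univ u)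
    rw [Real.norm_eq_abs, Real.norm_eq_abs, sub_zero, abs_of_nonneg hu.1] at this
    exact this.trans (by gcongr; exact hu.2)
  have hd : ∀ u, HasDerivAt (fun u => f u - u * f' 0) (f' u - f' 0) u := by
    intro u
    have h3 : HasDerivAt (fun u : ℝ => u * f' 0) (f' 0) u := by
      simpa using (hasDerivAt_id u).mul_const (f' 0)
    exact (h1 u).sub h3
  have := (convex_Icc (0:ℝ) ε).norm_image_sub_le_of_norm_hasDerivWithin_le
      (f := fun u => f u - u * f' 0) (f' := fun u => f' u - f' 0) (C := G * ε)
      (fun x _ => (hd x).hasDerivWithinAt) (fun x hx => a1 x hx)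
      (Set.left_mem_Icc.2 hε) (Set.right_mem_Icc.2 hε)
  rw [Real.norm_eq_abs, Real.norm_eq_abs, sub_zero, abs_of_nonneg hε, zero_mul, sub_zero] at this
  calc |f ε - f 0 - ε * f' 0| = |f ε - ε * f' 0 - f 0| := by congr 1; ring
    _ ≤ G * ε * ε := this
    _ = G * ε^2 := by ring

lemma flow_step (g : ℝ → ℝ) (hg : ContDiff ℝ (⊤ : ℕ∞) g) (hp : Function.Periodic g 1)
    (g0 : ℝ) (hg0 : 0 < g0) (hgb : ∀ x, g0 ≤ g x) (m : ℝ) (hm : 0 < m)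
    (hmb : ∀ s ∈ Set.Icc (0:ℝ) 1, ∀ x, m ≤ 1 + s * deriv g x) :
    ∃ K : ℝ, 0 < K ∧ ∀ s ∈ Set.Icc (0:ℝ) 1, ∀ ε : ℝ, 0 < ε → ∃ (Θ R : ℝ → ℝ) (α : ℝ), 0 < α ∧
      IsCircleDiffeo Θ ∧ IsCircleDiffeo R ∧ (∀ x, R (Θ x) = x) ∧
      (∀ x, |(R (Θ x + α) + s * g (R (Θ x + α))) - (x + (s + ε) * g x)| ≤ K * ε^2) ∧
      (∀ x, |deriv (fun x => R (Θ x + α) + s * g (R (Θ x + α))) x - (1 + (s + ε) * deriv g x)|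
        ≤ K * ε^2) := by
  have hg' : ContDiff ℝ (⊤ : ℕ∞) (deriv g) := (contDiff_infty_iff_deriv.1 hg).2
  have hg'' : ContDiff ℝ (⊤ : ℕ∞) (deriv (deriv g)) := (contDiff_infty_iff_deriv.1 hg').2
  have dg : ∀ x, HasDerivAt g (deriv g x) x := fun x => (hg.differentiable (by simp) x).hasDerivAt
  have dg' : ∀ x, HasDerivAt (deriv g) (deriv (deriv g) x) x :=
    fun x => (hg'.differentiable (by simp) x).hasDerivAt
  obtain ⟨M0, hM0, hM0b⟩ := periodic_bdd _ hg.continuous hp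
  obtain ⟨M1, hM1, hM1b⟩ := periodic_bdd _ hg'.continuous (periodic_deriv _ hp)
  obtain ⟨M2, hM2, hM2b⟩ := periodic_bdd _ hg''.continuous (periodic_deriv _ (periodic_deriv _ hp))
  simp only [Real.norm_eq_abs] at hM0b hM1b hM2b
  set G1 := M1 * (M0 * m⁻¹) with hG1
  set G2 := (M2 * (M0 * m⁻¹) * M0 + M1 * (M1 * (M0 * m⁻¹))) * m⁻¹
    + M1 * M0 * (M2 * (M0 * m⁻¹)) * (m⁻¹)^2 with hG2
  set K := G1 + (1 + M1) / g0 * G2 with hK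
  have hG1p : 0 < G1 := by positivity
  have hG2p : 0 < G2 := by positivity
  have hKp : 0 < K := by positivity
  refine ⟨K, hKp, ?_⟩
  intro s hs ε hε
  set b : ℝ → ℝ := fun x => 1 + s * deriv g x with hb
  have hbm : ∀ x, m ≤ b x := hmb s hs
  have hbp : ∀ x, 0 < b x := fun x => lt_of_lt_of_le hm (hbm x)
  have hgp : ∀ x, 0 < g x := fun x => lt_of_lt_of_le hg0 (hgb x)
  have hbs : ContDiff ℝ (⊤ : ℕ∞) b := contDiff_const.add (contDiff_const.mul hg')
  have hsm : ContDiff ℝ (⊤ : ℕ∞) (fun x => b x / g x) := hbs.div hg (fun x => (hgp x).ne')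
  have hc := hsm.continuous
  have hper : Function.Periodic (fun x => b x / g x) 1 := fun x => by
    simp only [hb, hp x, periodic_deriv _ hp x]
  set κ : ℝ → ℝ := fun x => ∫ z in (0:ℝ)..x, b z / g z with hκ
  have hκd : ∀ x, HasDerivAt κ (b x / g x) x := fun x =>
    intervalIntegral.integral_hasDerivAt_right (hc.intervalIntegrable _ _)
    (hc.stronglyMeasurableAtFilter _ _) hc.continuousAt
  have hκd' : deriv κ = fun x => b x / g x := funext fun x => (hκd x).deriv
  have hκs : ContDiff ℝ (⊤ : ℕ∞) κ := by
    rw [contDiff_infty_iff_deriv]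
    refine ⟨fun x => (hκd x).differentiableAt, ?_⟩
    rw [hκd']
    exact hsm
  set κ1 := ∫ z in (0:ℝ)..1, b z / g z with hκ1
  have hκ1p : 0 < κ1 := by
    apply intervalIntegral.intervalIntegral_pos_of_pos_on (hc.intervalIntegrable _ _) _ one_pos
    intro x _
    exact div_pos (hbp x) (hgp x)
  have hκT : ∀ x, κ (x+1) = κ x + κ1 := by
    intro x
    have e1 := hper.intervalIntegral_add_eq x 0
    have e2 := intervalIntegral.integral_add_adjacent_intervals
      (hc.intervalIntegrable (μ := volume) 0 x) (hc.intervalIntegrable x (x+1))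
    simp only [hκ]
    rw [← e2, e1, zero_add]
  have hκpos : ∀ x, 0 < deriv κ x := fun x => by
    rw [hκd']; exact div_pos (hbp x) (hgp x)
  obtain ⟨Q, q1, q2, q3, q4, q5, q6⟩ := exists_inverse κ κ1 hκ1p hκs hκT hκpos
  have hQ' : ∀ y, HasDerivAt Q (g (Q y) / b (Q y)) y := by
    intro y
    have := q5 y
    rw [hκd'] at this
    simpa using this
  have hRd : ∀ y, HasDerivAt (fun y => Q (κ1 * y)) (g (Q (κ1*y)) / b (Q (κ1*y)) * κ1) y := by
    intro y
    have e : HasDerivAt (fun y : ℝ => κ1 * y) κ1 y := by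
      simpa using (hasDerivAt_id y).const_mul κ1
    exact HasDerivAt.comp y (hQ' (κ1 * y)) e
  have hα : ∀ x, κ1 * (κ x / κ1 + ε/κ1) = κ x + ε := fun x => by field_simp
  have hEd : ∀ x, HasDerivAt (fun x => Q (κ x + ε))
      (g (Q (κ x + ε)) / b (Q (κ x + ε)) * (b x / g x)) x := fun x =>
    HasDerivAt.comp x (hQ' (κ x + ε)) ((hκd x).add_const ε)
  refine ⟨fun x => κ x / κ1, fun y => Q (κ1 * y), ε / κ1, by positivity,
    ⟨hκs.div_const _, fun x => ?_, fun x => ?_⟩,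
    ⟨q1.comp (contDiff_const.mul contDiff_id), fun y => ?_, fun y => ?_⟩, fun x => ?_,
    fun x => ?_, fun x => ?_⟩
  · simp only [hκT]
    field_simp
  · rw [deriv_div_const]
    exact div_pos (hκpos x) hκ1p
  · simp only [mul_add, mul_one, q4]
  · rw [(hRd y).deriv]
    exact mul_pos (div_pos (hgp _) (hbp _)) hκ1p
  · change Q (κ1 * (κ x / κ1)) = x
    rw [mul_div_cancel₀ _ hκ1p.ne', q2]
  · simp only [hα]
    set E : ℝ → ℝ := fun u => Q (κ x + u) with hE
    have hEu : ∀ u, HasDerivAt E (g (E u) / b (E u)) u := fun u => by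
      have := HasDerivAt.comp_const_add (κ x) u (hQ' (κ x + u))
      exact this
    have hE0 : E 0 = x := by simp only [hE, add_zero, q2]
    have d1 : ∀ u, HasDerivAt (fun u => E u + s * g (E u)) (g (E u)) u := by
      intro u
      have := (hEu u).add ((HasDerivAt.comp u (dg (E u)) (hEu u)).const_mul s)
      have e : g (E u) = g (E u) / b (E u) + s * (deriv g (E u) * (g (E u) / b (E u))) := by
        have := (hbp (E u)).ne'
        field_simp
        simp only [hb]
      rw [e]
      exact this
    have d2 : ∀ u, HasDerivAt (fun u => g (E u)) (deriv g (E u) * (g (E u) / b (E u))) u :=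
      fun u => HasDerivAt.comp u (dg (E u)) (hEu u)
    have bd : ∀ u, |deriv g (E u) * (g (E u) / b (E u))| ≤ G1 := by
      intro u
      rw [div_eq_mul_inv, abs_mul, abs_mul, abs_of_pos (inv_pos.2 (hbp (E u)))]
      have hbi := hbm (E u)
      have i0 := hM0b (E u)
      have i1 := hM1b (E u)
      have hbu := hbp (E u)
      rw [hG1]
      gcongr
    have := taylor_two _ _ _ G1 ε hε.le d1 d2 bd
    simp only [hE0] at this
    have e : E ε + s * g (E ε) - (x + (s + ε) * g x)
      = E ε + s * g (E ε) - (x + s * g x) - ε * g x := by ring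
    change |E ε + s * g (E ε) - (x + (s + ε) * g x)| ≤ _
    rw [e]
    refine this.trans ?_
    gcongr
    rw [hK]
    have : 0 < (1 + M1) / g0 * G2 := by positivity
    linarith
  · simp only [hα]
    set E : ℝ → ℝ := fun u => Q (κ x + u) with hE
    have hEu : ∀ u, HasDerivAt E (g (E u) / b (E u)) u := fun u => by
      have := HasDerivAt.comp_const_add (κ x) u (hQ' (κ x + u))
      exact this
    have hE0 : E 0 = x := by simp only [hE, add_zero, q2]
    have d2 : ∀ u, HasDerivAt (fun u => g (E u)) (deriv g (E u) * g (E u) / b (E u)) u :=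
      fun u => by
        have := HasDerivAt.comp u (dg (E u)) (hEu u)
        rw [← mul_div_assoc] at this
        exact this
    have db : ∀ u, HasDerivAt (fun u => b (E u))
        (s * (deriv (deriv g) (E u) * (g (E u) / b (E u)))) u := fun u =>
      ((HasDerivAt.comp u (dg' (E u)) (hEu u)).const_mul s).const_add 1
    have d3 : ∀ u, HasDerivAt (fun u => deriv g (E u) * g (E u) / b (E u))
        (((deriv (deriv g) (E u) * (g (E u) / b (E u)) * g (E u) +
          deriv g (E u) * (deriv g (E u) * (g (E u) / b (E u)))) * b (E u) -
          deriv g (E u) * g (E u) * (s * (deriv (deriv g) (E u) * (g (E u) / b (E u)))))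
          / (b (E u))^2) u := by
      intro u
      have := ((HasDerivAt.comp u (dg' (E u)) (hEu u)).mul
        (HasDerivAt.comp u (dg (E u)) (hEu u))).div (db u) (hbp (E u)).ne'
      exact this
    have bd : ∀ u, |(((deriv (deriv g) (E u) * (g (E u) / b (E u)) * g (E u) +
          deriv g (E u) * (deriv g (E u) * (g (E u) / b (E u)))) * b (E u) -
          deriv g (E u) * g (E u) * (s * (deriv (deriv g) (E u) * (g (E u) / b (E u)))))
          / (b (E u))^2)| ≤ G2 := by
      intro u
      have hbu := hbp (E u)
      have hbi : (b (E u))⁻¹ ≤ m⁻¹ := by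
        have := hbm (E u)
        gcongr
      have hbi0 : 0 < (b (E u))⁻¹ := inv_pos.2 hbu
      have i0 := hM0b (E u)
      have i1 := hM1b (E u)
      have i2 := hM2b (E u)
      generalize deriv (deriv g) (E u) = z2 at *
      generalize deriv g (E u) = z1 at *
      generalize g (E u) = z0 at *
      have e : ((z2 * (z0 / b (E u)) * z0 + z1 * (z1 * (z0 / b (E u)))) * b (E u) -
          z1 * z0 * (s * (z2 * (z0 / b (E u))))) / (b (E u))^2
          = (z2 * (z0 * (b (E u))⁻¹) * z0 + z1 * (z1 * (z0 * (b (E u))⁻¹))) * (b (E u))⁻¹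
            - s * (z1 * z0 * (z2 * (z0 * (b (E u))⁻¹)) * ((b (E u))⁻¹)^2) := by
        field_simp
      rw [e]
      generalize (b (E u))⁻¹ = v at *
      have s0 := hs.1
      have s1 := hs.2
      have t1 : |z2 * (z0 * v) * z0| ≤ M2 * (M0 * m⁻¹) * M0 := by
        rw [abs_mul, abs_mul, abs_mul, abs_of_pos hbi0]; gcongr
      have t2 : |z1 * (z1 * (z0 * v))| ≤ M1 * (M1 * (M0 * m⁻¹)) := by
        rw [abs_mul, abs_mul, abs_mul, abs_of_pos hbi0]; gcongr
      have t3 : |s * (z1 * z0 * (z2 * (z0 * v)) * v^2)| ≤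
          1 * (M1 * M0 * (M2 * (M0 * m⁻¹)) * (m⁻¹)^2) := by
        rw [abs_mul, abs_mul, abs_mul, abs_mul, abs_mul, abs_mul, abs_pow, abs_of_pos hbi0,
          abs_of_nonneg s0]
        gcongr
      refine (abs_sub _ _).trans ?_
      rw [hG2]
      refine add_le_add ?_ (by rw [one_mul] at t3; exact t3)
      rw [abs_mul, abs_of_pos hbi0]
      gcongr
      exact (abs_add_le _ _).trans (add_le_add t1 t2)
    have tay := taylor_two _ _ _ G2 ε hε.le d2 d3 bd
    simp only [hE0] at tay
    have hA : HasDerivAt (fun x => Q (κ x + ε) + s * g (Q (κ x + ε))) (g (E ε) * (b x / g x)) x := by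
      have := (hEd x).add ((HasDerivAt.comp x (dg (Q (κ x + ε))) (hEd x)).const_mul s)
      have e : g (E ε) * (b x / g x) = g (E ε) / b (E ε) * (b x / g x) +
          s * (deriv g (E ε) * (g (E ε) / b (E ε) * (b x / g x))) := by
        have := (hbp (E ε)).ne'
        have := (hgp x).ne'
        field_simp
        simp only [hb]
      rw [e]
      exact this
    rw [hA.deriv]
    have e : g (E ε) * (b x / g x) - (1 + (s + ε) * deriv g x)
        = (b x / g x) * (g (E ε) - g x - ε * (deriv g x * g x / b x)) := by
      have h1 := (hbp x).ne'
      have h2 := (hgp x).ne'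
      have h3 : 1 + (s + ε) * deriv g x = b x + ε * deriv g x := by simp only [hb]; ring
      rw [h3]
      field_simp
      ring
    rw [e, abs_mul, abs_of_pos (div_pos (hbp x) (hgp x))]
    have hb1 : b x ≤ 1 + M1 := by
      have h1 := (le_abs_self _).trans (hM1b x)
      have : s * deriv g x ≤ 1 * M1 := by
        have h2 := hM1b x
        calc s * deriv g x ≤ s * M1 := mul_le_mul_of_nonneg_left h1 hs.1
          _ ≤ 1 * M1 := mul_le_mul_of_nonneg_right hs.2 hM1.le
      simp only [hb]; linarith
    calc b x / g x * |g (E ε) - g x - ε * (deriv g x * g x / b x)|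
        ≤ (1 + M1) / g0 * (G2 * ε^2) := by
          have := hgb x
          gcongr
      _ ≤ K * ε^2 := by
          rw [hK]
          nlinarith [mul_pos hG1p (pow_pos hε 2)]

/-! ### Conclusion -/

lemma geodDist_comp_eq_zero {d : ℕ} (q : ℝ) (hq0 : 0 ≤ q) (hq : q ≤ 1/2) (c₀ : ℝ → Edim d)
    (hc₀ : c₀ ∈ Imm d) (φ₁ : ℝ → ℝ) (hφ₁ : IsCircleDiffeo φ₁) :
    geodDist q (Imm d) c₀ (c₀ ∘ φ₁) = 0 := by
  have hper0 : Function.Periodic (fun x => φ₁ x - x) 1 := fun x => by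
    simp only [hφ₁.2.1]; ring
  obtain ⟨M, hM, hMb⟩ := periodic_bdd (fun x => φ₁ x - x)
    (hφ₁.1.continuous.sub continuous_id) hper0
  obtain ⟨k, hk⟩ := exists_nat_gt M
  set g : ℝ → ℝ := fun x => φ₁ x + k - x with hg
  have hgs : ContDiff ℝ (⊤ : ℕ∞) g := (hφ₁.1.add contDiff_const).sub contDiff_id
  have hgp : Function.Periodic g 1 := fun x => by
    simp only [hg, hφ₁.2.1]; ring
  have hgb : ∀ x, k - M ≤ g x := by
    intro x
    have := (neg_le_abs (φ₁ x - x)).trans (hMb x)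
    simp only [hg]; linarith
  have hgd : ∀ x, HasDerivAt g (deriv φ₁ x - 1) x := fun x =>
    ((hφ₁.differentiable x).hasDerivAt.add_const (k:ℝ)).sub (hasDerivAt_id x)
  have hgd' : ∀ x, deriv g x = deriv φ₁ x - 1 := fun x => (hgd x).deriv
  obtain ⟨m1, hm1, hm1b⟩ := periodic_pos _ hφ₁.contDiff_deriv.continuous
    (deriv_periodic_of_shift φ₁ 1 hφ₁.2.1) hφ₁.2.2
  set m := min 1 m1 with hm
  have hmp : 0 < m := lt_min one_pos hm1
  have hmb : ∀ s ∈ Set.Icc (0:ℝ) 1, ∀ x, m ≤ 1 + s * deriv g x := by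
    intro s hs x
    rw [hgd']
    have h1 : m ≤ 1 := min_le_left _ _
    have h2 : m ≤ deriv φ₁ x := (min_le_right _ _).trans (hm1b x)
    nlinarith [mul_nonneg hs.1 (sub_nonneg.2 h2), mul_nonneg (sub_nonneg.2 hs.2) (sub_nonneg.2 h1)]
  obtain ⟨K, hK, hstep⟩ := flow_step g hgs hgp (k - M) (by linarith) hgb m hmp hmb
  obtain ⟨C, hC, hlin⟩ := reach_linear q hq0 hq c₀ hc₀ (m/2) (by positivity)
  set φ : ℝ → ℝ → ℝ := fun s x => x + s * g x with hφ
  have hφd : ∀ s x, deriv (φ s) x = 1 + s * deriv g x := fun s x =>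
    ((hasDerivAt_id x).add ((hgs.differentiable (by simp) x).hasDerivAt.const_mul s)).deriv
  have hφc : ∀ s ∈ Set.Icc (0:ℝ) 1, IsCircleDiffeo (φ s) := by
    intro s hs
    refine ⟨contDiff_id.add (contDiff_const.mul hgs), fun x => ?_, fun x => ?_⟩
    · simp only [hφ, hgp x]; ring
    · rw [hφd]; exact lt_of_lt_of_le hmp (hmb s hs x)
  have hone : ∀ s ∈ Set.Icc (0:ℝ) 1, ∀ ε : ℝ, 0 < ε → s + ε ∈ Set.Icc (0:ℝ) 1 →
      K * ε^2 ≤ m/2 → Reach q (c₀ ∘ φ s) (c₀ ∘ φ (s + ε)) 2 (C * (K * ε^2)) := by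
    intro s hs ε hε hsε hsmall
    obtain ⟨Θ, R, α, hα, hΘ, hR, hRΘ, hD, hD'⟩ := hstep s hs ε hε
    have hδ : 0 < C * (K * ε^2) := by positivity
    have hrot := reach_rotate q hq0 hq (c₀ ∘ (φ s ∘ R)) (Imm.comp hc₀ ((hφc s hs).comp hR)) Θ hΘ α hα
      _ hδ
    have e1 : (c₀ ∘ (φ s ∘ R)) ∘ Θ = c₀ ∘ φ s := by
      ext1 x
      simp only [Function.comp, hRΘ]
    set A : ℝ → ℝ := fun x => R (Θ x + α) + s * g (R (Θ x + α)) with hA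
    have e2 : (fun x => (c₀ ∘ (φ s ∘ R)) (Θ x + α)) = c₀ ∘ A := rfl
    rw [e1, e2] at hrot
    have hAc : IsCircleDiffeo A := ((hφc s hs).comp hR).comp (hΘ.add_const α)
    have hBd : ∀ x, m ≤ deriv (φ (s+ε)) x := fun x => by rw [hφd]; exact hmb _ hsε x
    have hl := hlin A (φ (s+ε)) hAc (hφc _ hsε)
      (fun x => by
        have h1 := (neg_le_abs _).trans (hD' x)
        have h2 := hBd x
        rw [hφd] at h2
        linarith)
      (fun x => (by linarith : m/2 ≤ m).trans (hBd x)) (K * ε^2) (by positivity)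
      (fun x => by rw [abs_sub_comm]; exact hD x)
      (fun x => by rw [abs_sub_comm, hφd]; exact hD' x)
    have := hrot.trans zero_le_one zero_le_one hl
    norm_num at this
    exact this
  have hbound : ∀ n : ℕ, 0 < n → K * (1/n)^2 ≤ m/2 →
      geodDist q (Imm d) c₀ (c₀ ∘ φ₁) ≤ ENNReal.ofReal (2 * C * K * (1/n)) := by
    intro n hn hsmall
    have hn' : (0:ℝ) < n := by exact_mod_cast hn
    have hch := Reach.chain (q := q) (fun j : ℕ => c₀ ∘ φ (j/n)) (T := 2) (L := C * (K * (1/n)^2))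
      (by norm_num) (by positivity)
      (Imm.comp hc₀ (hφc _ ⟨by positivity, by simp⟩)) n
      (fun j hj => by
        have hj' : (j:ℝ) + 1 ≤ n := by exact_mod_cast hj
        have e : ((j+1:ℕ):ℝ)/n = j/n + 1/n := by push_cast; ring
        have hle : (j:ℝ)/n + 1/n ≤ 1 := by
          rw [← add_div, div_le_one hn']; exact hj'
        have hp0 : (0:ℝ) ≤ j/n := by positivity
        have hp1 : (0:ℝ) < 1/n := by positivity
        change Reach q (c₀ ∘ φ (j/n)) (c₀ ∘ φ ((j+1:ℕ)/n)) 2 _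
        rw [e]
        exact hone _ ⟨hp0, by linarith⟩ _ hp1 ⟨by linarith, hle⟩ hsmall)
    have e0 : c₀ ∘ φ ((0:ℕ)/n) = c₀ := by
      ext1 x
      simp [hφ]
    have e1 : c₀ ∘ φ ((n:ℝ)/n) = c₀ ∘ φ₁ := by
      ext1 x
      simp only [hφ, hg, Function.comp, div_self hn'.ne']
      have h1 : x + 1 * (φ₁ x + k - x) = φ₁ x + k * 1 := by ring
      rw [h1]
      exact (hc₀.1.nat_mul k) (φ₁ x)
    rw [e0, e1] at hch
    have := hch.geodDist_le (by positivity)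
    convert this using 2
    field_simp
  have hlim : Filter.Tendsto (fun n : ℕ => (1:ℝ)/n) Filter.atTop (nhds 0) :=
    tendsto_one_div_atTop_nhds_zero_nat
  have hl1 : Filter.Tendsto (fun n : ℕ => ENNReal.ofReal (2 * C * K * (1/n))) Filter.atTop
      (nhds 0) := by
    have := ENNReal.tendsto_ofReal (hlim.const_mul (2 * C * K))
    simpa using this
  have hl2 : Filter.Tendsto (fun n : ℕ => K * ((1:ℝ)/n)^2) Filter.atTop (nhds 0) := by
    have := (hlim.pow 2).const_mul K
    simpa using this
  have hev : ∀ᶠ n : ℕ in Filter.atTop, K * ((1:ℝ)/n)^2 ≤ m/2 :=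
    hl2.eventually_le_const (by positivity)
  refine le_antisymm (ge_of_tendsto hl1 ?_) bot_le
  filter_upwards [hev, Filter.eventually_gt_atTop 0] with n h1 h2
  exact hbound n h2 h1

/-- The unit circle in a coordinate plane. -/
lemma circle_mem {d : ℕ} (i j : Fin d) (hij : i ≠ j) :
    (fun θ : ℝ => Real.cos (2 * Real.pi * θ) • EuclideanSpace.single i (1:ℝ) +
      Real.sin (2 * Real.pi * θ) • EuclideanSpace.single j (1:ℝ)) ∈ Imm d := by
  refine ⟨fun θ => ?_, ?_, fun θ => ?_⟩
  · simp only [mul_add, mul_one, Real.cos_add_two_pi, Real.sin_add_two_pi]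
  · apply ContDiff.add
    · exact (Real.contDiff_cos.comp (contDiff_const.mul contDiff_id)).smul contDiff_const
    · exact (Real.contDiff_sin.comp (contDiff_const.mul contDiff_id)).smul contDiff_const
  · have h0 : HasDerivAt (fun θ : ℝ => 2 * Real.pi * θ) (2 * Real.pi) θ := by
      simpa using (hasDerivAt_id θ).const_mul (2 * Real.pi)
    have h1 := (h0.cos.smul_const (EuclideanSpace.single i (1:ℝ))).add
      (h0.sin.smul_const (EuclideanSpace.single j (1:ℝ)))
    intro h
    have h2 := h1.deriv.symm.trans h
    have hpi := Real.pi_pos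
    have hi := congrArg (fun v : Edim d => v i) h2
    have hj := congrArg (fun v : Edim d => v j) h2
    simp [hij, hij.symm, hpi.ne'] at hi hj
    have := Real.sin_sq_add_cos_sq (2 * Real.pi * θ)
    rw [hi, hj] at this
    norm_num at this

/-- degeneracy of the geodesic distance for `0 ≤ q ≤ 1/2`. -/
theorem geodDist_degenerate_of_le_half (d : ℕ) (q : ℝ) (hq0 : 0 ≤ q) (hq : q ≤ 1 / 2) :
    (∀ c₀ : ℝ → Edim d, c₀ ∈ Imm d → ∀ φ₁ : ℝ → ℝ, IsCircleDiffeo φ₁ →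
      geodDist q (Imm d) c₀ (c₀ ∘ φ₁) = 0) ∧
    (2 ≤ d → ∃ c₀ c₁ : ℝ → Edim d, c₀ ∈ Imm d ∧ c₁ ∈ Imm d ∧ c₀ ≠ c₁ ∧
      geodDist q (Imm d) c₀ c₁ = 0) := by
  refine ⟨fun c₀ hc₀ φ₁ hφ₁ => geodDist_comp_eq_zero q hq0 hq c₀ hc₀ φ₁ hφ₁, fun hd => ?_⟩
  set i : Fin d := ⟨0, by omega⟩ with hi
  set j : Fin d := ⟨1, by omega⟩ with hj
  have hij : i ≠ j := by simp [hi, hj]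
  have hc := circle_mem i j hij
  have hφ : IsCircleDiffeo (fun x : ℝ => x + 1/2) := by
    refine ⟨contDiff_id.add contDiff_const, fun x => by ring, fun x => ?_⟩
    rw [deriv_add_const, deriv_id'']
    exact one_pos
  refine ⟨_, _, hc, Imm.comp hc hφ, fun h => ?_, geodDist_comp_eq_zero q hq0 hq _ hc _ hφ⟩
  have h0 := congrArg (fun v : Edim d => v i) (congrFun h 0)
  have e : 2 * Real.pi * 2⁻¹ = Real.pi := by ring
  simp [e] at h0
  norm_num at h0

end
end

section
/- Let b > 1/2 and 0 ≤ a ≤ b. Then there is a constant C = C(a,b) > 0 such that for all f ∈ H^a(S¹,ℝ) and g ∈ H^b(S¹,ℝ) the pointwise product satisfies ‖f·g‖_{H^a} ≤ C ‖f‖_{H^a} ‖g‖_{H^b}. -/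
open MeasureTheory intervalIntegral
open scoped BigOperators ENNReal RealInnerProductSpace

noncomputable section

namespace SobAux

abbrev Circ := AddCircle (1:ℝ)
abbrev μc : Measure Circ := AddCircle.haarAddCircle

/-- integration of continuous functions against an integrable function -/
def pairing (F : Circ → ℂ) (hF : Integrable F μc) : C(Circ, ℂ) →L[ℂ] ℂ :=
  LinearMap.mkContinuous
    { toFun := fun φ => ∫ x, φ x * F x ∂μc
      map_add' := by
        intro φ ψ
        simp only [ContinuousMap.add_apply, add_mul]
        exact integral_add (hF.bdd_mul (c := ‖φ‖) (by fun_prop) (ae_of_all _ φ.norm_coe_le_norm))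
          (hF.bdd_mul (c := ‖ψ‖) (by fun_prop) (ae_of_all _ ψ.norm_coe_le_norm))
      map_smul' := by
        intro c φ
        simp only [ContinuousMap.smul_apply, smul_eq_mul, mul_assoc, RingHom.id_apply]
        exact integral_const_mul _ _ }
    (∫ x, ‖F x‖ ∂μc) (by
      intro φ
      simp only [LinearMap.coe_mk, AddHom.coe_mk]
      rw [← MeasureTheory.integral_mul_const]
      refine norm_integral_le_of_norm_le (hF.norm.mul_const _) (ae_of_all _ fun x => ?_)
      rw [norm_mul, mul_comm]
      gcongr
      exact φ.norm_coe_le_norm x)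

lemma pairing_apply (F : Circ → ℂ) (hF : Integrable F μc) (φ : C(Circ, ℂ)) :
    pairing F hF φ = ∫ x, φ x * F x ∂μc := rfl

lemma pairing_fourier (F : Circ → ℂ) (hF : Integrable F μc) (n : ℤ) :
    pairing F hF (fourier n) = fourierCoeff F (-n) := by
  rw [pairing_apply, fourierCoeff]; simp

lemma ae_zero (D : Circ → ℂ) (hD : Integrable D μc) (h : ∀ n, fourierCoeff D n = 0) :
    D =ᵐ[μc] 0 := by
  have h0 : ∀ φ : C(Circ, ℂ), pairing D hD φ = 0 := by
    intro φ
    have hle : (Submodule.span ℂ (Set.range (fourier (T := (1:ℝ))))).topologicalClosure ≤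
        LinearMap.ker (pairing D hD : C(Circ, ℂ) →ₗ[ℂ] ℂ) := by
      refine Submodule.topologicalClosure_minimal _ ?_ (pairing D hD).isClosed_ker
      rw [Submodule.span_le]
      rintro _ ⟨n, rfl⟩
      simp [pairing_fourier, h]
    rw [span_fourier_closure_eq_top] at hle
    exact hle (Submodule.mem_top (x := φ))
  refine ae_eq_zero_of_forall_setIntegral_isClosed_eq_zero hD fun s hs => ?_
  have key : Filter.Tendsto (fun n : ℕ => ∫ x, ((hs.apprSeq n x : ℝ) : ℂ) * D x ∂μc) Filter.atTop
      (nhds (∫ x, s.indicator D x ∂μc)) := by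
    refine tendsto_integral_of_dominated_convergence (fun x => ‖D x‖) ?_ hD.norm ?_ ?_
    · intro n
      refine AEStronglyMeasurable.mul ?_ hD.1
      exact Continuous.aestronglyMeasurable (by fun_prop)
    · intro n
      refine ae_of_all _ fun x => ?_
      rw [norm_mul]
      have := HasOuterApproxClosed.apprSeq_apply_le_one hs n x
      have h1 : ‖((hs.apprSeq n x : ℝ) : ℂ)‖ ≤ 1 := by
        simpa using this
      nlinarith [norm_nonneg (D x)]
    · refine ae_of_all _ fun x => ?_
      have h1 := (tendsto_pi_nhds.1 (HasOuterApproxClosed.tendsto_apprSeq hs)) x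
      have h2 : Filter.Tendsto (fun n => ((hs.apprSeq n x : ℝ) : ℂ) * D x) Filter.atTop
        (nhds ((((s.indicator (fun _ => (1:NNReal)) x : NNReal) : ℝ) : ℂ) * D x)) := by
        refine Filter.Tendsto.mul_const _ ?_
        exact (Complex.continuous_ofReal.comp NNReal.continuous_coe).tendsto _ |>.comp h1
      convert h2 using 2
      by_cases hx : x ∈ s <;> simp [hx]
  have hz : ∀ n : ℕ, ∫ x, ((hs.apprSeq n x : ℝ) : ℂ) * D x ∂μc = 0 := by
    intro n
    exact h0 ⟨fun x => ((hs.apprSeq n x : ℝ) : ℂ), by fun_prop⟩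
  simp only [hz] at key
  rw [← MeasureTheory.integral_indicator hs.measurableSet]
  exact (tendsto_nhds_unique key tendsto_const_nhds)

lemma conv_hasSum (f g : Circ → ℂ) (hf : Integrable f μc) (hg : Integrable g μc)
    (hs : Summable (fun n => ‖fourierCoeff g n‖)) (n : ℤ) :
    HasSum (fun k => fourierCoeff g k * fourierCoeff f (n - k))
      (fourierCoeff (fun x => f x * g x) n) := by
  have hsum : Summable (fun k : ℤ => fourierCoeff g k • (fourier k : C(Circ, ℂ))) := by
    refine Summable.of_norm ?_
    simp_rw [norm_smul, fourier_norm, mul_one]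
    exact hs
  obtain ⟨h, hh⟩ := hsum
  have main : ∀ (F : Circ → ℂ) (hF : Integrable F μc) (n : ℤ),
      HasSum (fun k => fourierCoeff g k * fourierCoeff F (n - k))
        (fourierCoeff (fun x => F x * h x) n) := by
    intro F hF n
    have h1 := (hh.mul_left (fourier (-n) : C(Circ, ℂ))).mapL (pairing F hF)
    convert h1 using 1
    · ext k
      have : (fourier (-n) : C(Circ, ℂ)) * (fourierCoeff g k • (fourier k : C(Circ, ℂ)))
          = fourierCoeff g k • (fourier (-n + k) : C(Circ, ℂ)) := by
        ext x
        simp only [ContinuousMap.mul_apply, ContinuousMap.smul_apply, fourier_add, smul_eq_mul]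
        ring
      rw [this, map_smul, pairing_fourier, smul_eq_mul]
      congr 2; ring
    · rw [pairing_apply, fourierCoeff]
      congr 1; ext x
      simp only [ContinuousMap.mul_apply, smul_eq_mul]; ring
  have hint : Integrable (fun x => h x) μc := 
    (integrable_const (1:ℂ)).bdd_mul (c := ‖h‖) (by fun_prop) (ae_of_all _ h.norm_coe_le_norm)
      |>.congr (ae_of_all _ fun x => by simp)
  have hcoef : ∀ n, fourierCoeff (fun x => h x) n = fourierCoeff g n := by
    intro n
    have h1 := main (fun _ => 1) (integrable_const _) n
    have hone : fourierCoeff (T := (1:ℝ)) (fun _ => (1:ℂ)) = Pi.single 0 1 := by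
      rw [← fourierCoeff_fourier (T := (1:ℝ))]
      congr 1; ext x; simp
    simp only [hone, one_mul] at h1
    refine h1.unique ?_
    convert hasSum_single n ?_ using 1
    · simp
    · intro k hk
      rw [Pi.single_eq_of_ne (by omega)]; simp
  have hae : (fun x => g x - h x) =ᵐ[μc] 0 := by
    refine ae_zero _ (hg.sub hint) fun n => ?_
    have := fourierCoeff.add hg (hint.neg)
    have h2 : fourierCoeff (fun x => g x - h x) n
      = fourierCoeff g n - fourierCoeff (fun x => h x) n := by
      simp only [fourierCoeff, smul_sub]
      exact integral_sub (hg.fourier_smul _) (hint.fourier_smul _)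
    rw [h2, hcoef, sub_self]
  have hfin := main f hf n
  have hc : (fun x => f x * g x) =ᵐ[μc] fun x => f x * h x := by
    filter_upwards [hae] with x hx
    simp only [Pi.zero_apply, sub_eq_zero] at hx
    rw [hx]
  rw [fourierCoeff_congr_ae hc]
  exact hfin

/-- lift to the circle -/
def lft (f : ℝ → ℝ) : Circ → ℂ := AddCircle.liftIoc 1 0 (fun x => (f x : ℂ))

lemma lft_mul (f g : ℝ → ℝ) : lft (fun x => f x * g x) = fun x => lft f x * lft g x := by
  ext x; simp [lft, AddCircle.liftIoc, Set.domRestrict]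

lemma lft_int (f : ℝ → ℝ) (hf : IntegrableOn f (Set.Ioc (0:ℝ) 1)) : Integrable (lft f) μc := by
  have h1 : MemLp (fun x => (f x : ℂ)) 1 (volume.restrict (Set.Ioc (0:ℝ) (0+1))) := by
    rw [zero_add, memLp_one_iff_integrable]
    exact hf.ofReal
  have h2 := h1.memLp_liftIoc
  rw [memLp_one_iff_integrable, AddCircle.volume_eq_smul_haarAddCircle] at h2
  rw [ENNReal.ofReal_one, one_smul] at h2
  exact h2

lemma lft_coeff (f : ℝ → ℝ) (n : ℤ) : fourierCoeff (lft f) n = fCoeff f n := by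
  rw [lft, fourierCoeff_liftIoc_eq, fourierCoeffOn_eq_integral, fCoeff]
  simp only [add_sub_cancel_left, zero_add]
  rw [sub_zero, div_one, one_smul]
  congr 1; ext x
  rw [fourier_coe_apply, smul_eq_mul]
  congr 2; push_cast; ring

lemma prod_coeff (f g : ℝ → ℝ) (hf : IntegrableOn f (Set.Ioc (0:ℝ) 1))
    (hg : IntegrableOn g (Set.Ioc (0:ℝ) 1)) (hs : Summable (fun n => ‖fCoeff g n‖)) (n : ℤ) :
    HasSum (fun k => fCoeff g k * fCoeff f (n - k)) (fCoeff (fun x => f x * g x) n) := by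
  have := conv_hasSum (lft f) (lft g) (lft_int f hf) (lft_int g hg) (by simpa [lft_coeff] using hs) n
  rw [← lft_mul] at this
  simpa only [lft_coeff] using this

end SobAux

namespace SobAux

lemma cs (x y : ℤ → ℝ≥0∞) : (∑' k, x k * y k) ^ 2 ≤ (∑' k, x k ^ 2) * (∑' k, y k ^ 2) := by
  have h := ENNReal.lintegral_mul_le_Lp_mul_Lq (Measure.count (α := ℤ))
    Real.HolderConjugate.two_two (f := x) (g := y) (by fun_prop) (by fun_prop)
  simp only [lintegral_count, Pi.mul_apply] at h
  calc _ ≤ _ := pow_le_pow_left' h 2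
    _ = _ := by
      rw [mul_pow, ← ENNReal.rpow_natCast, ← ENNReal.rpow_natCast, ← ENNReal.rpow_mul,
        ← ENNReal.rpow_mul]
      norm_num

lemma cs_weight (u p : ℤ → ℝ≥0∞) :
    (∑' k, u k * p k) ^ 2 ≤ (∑' k, p k) * (∑' k, u k ^ 2 * p k) := by
  have hr : ∀ k, (p k ^ (1/2:ℝ)) ^ 2 = p k := by
    intro k
    rw [← ENNReal.rpow_natCast, ← ENNReal.rpow_mul]; norm_num
  have h := cs (fun k => p k ^ (1/2:ℝ)) (fun k => u k * p k ^ (1/2:ℝ))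
  simp only [mul_pow, hr] at h
  refine le_trans (le_of_eq ?_) h
  congr 2; ext k
  rw [mul_left_comm, ← pow_two, hr]

lemma young (u p : ℤ → ℝ≥0∞) :
    ∑' n, (∑' k, u (n - k) * p k) ^ 2 ≤ (∑' k, p k) ^ 2 * ∑' k, u k ^ 2 := by
  calc _ ≤ ∑' n, (∑' k, p k) * (∑' k, u (n - k) ^ 2 * p k) :=
        ENNReal.tsum_le_tsum fun n => cs_weight (fun k => u (n - k)) p
    _ = (∑' k, p k) * ∑' k, ∑' n, u (n - k) ^ 2 * p k := by
        rw [ENNReal.tsum_mul_left, ENNReal.tsum_comm]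
    _ = (∑' k, p k) * ∑' k, (∑' n, u n ^ 2) * p k := by
        congr 2; ext k
        rw [ENNReal.tsum_mul_right]
        congr 1
        exact (Equiv.subRight k).tsum_eq (fun n => u n ^ 2)
    _ = _ := by rw [ENNReal.tsum_mul_left]; ring

lemma young3 (u v s : ℤ → ℝ≥0∞) :
    ∑' n, (∑' k, u (n - k) * (v k * s k)) ^ 2 ≤
      (∑' k, u k ^ 2) * (∑' k, v k ^ 2) * ∑' k, s k ^ 2 := by
  refine (young u (fun k => v k * s k)).trans ?_
  calc _ ≤ ((∑' k, v k ^ 2) * ∑' k, s k ^ 2) * ∑' k, u k ^ 2 := by gcongr; exact cs v s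
    _ = _ := by ring

lemma young3' (u v s : ℤ → ℝ≥0∞) :
    ∑' n, (∑' k, v k * (u (n - k) * s (n - k))) ^ 2 ≤
      (∑' k, u k ^ 2) * (∑' k, v k ^ 2) * ∑' k, s k ^ 2 := by
  have := young3 v u s
  rw [mul_comm (∑' k, v k ^ 2)] at this
  refine le_trans (le_of_eq ?_) this
  congr 1; ext n; congr 1
  rw [← (Equiv.subLeft n).tsum_eq]
  simp

lemma sq_add_le (x y : ℝ≥0∞) : (x + y) ^ 2 ≤ 2 * (x ^ 2 + y ^ 2) := by
  have := ENNReal.rpow_add_le_mul_rpow_add_rpow x y (p := 2) (by norm_num)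
  norm_num at this
  exact_mod_cast this

lemma total (u v s t : ℤ → ℝ≥0∞) (K : ℝ≥0∞)
    (h : ∀ n, t n ≤ K * (∑' k, u (n - k) * (v k * s k) + ∑' k, v k * (u (n - k) * s (n - k)))) :
    ∑' n, t n ^ 2 ≤ 4 * K ^ 2 * (∑' k, s k ^ 2) * ((∑' k, u k ^ 2) * ∑' k, v k ^ 2) := by
  calc _ ≤ ∑' n, K ^ 2 * (2 * ((∑' k, u (n - k) * (v k * s k)) ^ 2 +
            (∑' k, v k * (u (n - k) * s (n - k))) ^ 2)) := by
        refine ENNReal.tsum_le_tsum fun n => ?_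
        refine (pow_le_pow_left' (h n) 2).trans ?_
        rw [mul_pow]
        gcongr
        exact sq_add_le _ _
    _ ≤ K ^ 2 * (2 * ((∑' k, u k ^ 2) * (∑' k, v k ^ 2) * (∑' k, s k ^ 2) +
          (∑' k, u k ^ 2) * (∑' k, v k ^ 2) * ∑' k, s k ^ 2)) := by
        rw [ENNReal.tsum_mul_left, ENNReal.tsum_mul_left, ENNReal.tsum_add]
        gcongr
        · exact young3 u v s
        · exact young3' u v s
    _ = _ := by ring

lemma key_real (a b : ℝ) (ha : 0 ≤ a) (hab : a ≤ b) (m k : ℝ) :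
    (1 + (m + k) ^ 2) ^ (a/2) ≤ 4 ^ (a/2) * ((1 + m ^ 2) ^ (a/2) +
      (1 + k ^ 2) ^ (b/2) * ((1 + m ^ 2) ^ (a/2) * (1 + m ^ 2) ^ (-(b/2)))) := by
  have hm : (0:ℝ) < 1 + m ^ 2 := by positivity
  have hk : (0:ℝ) < 1 + k ^ 2 := by positivity
  have ha2 : 0 ≤ a / 2 := by linarith
  rcases le_total (1 + k ^ 2) (1 + m ^ 2) with h | h
  · have h1 : 1 + (m + k) ^ 2 ≤ 4 * (1 + m ^ 2) := by nlinarith [sq_nonneg (m - k)]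
    calc _ ≤ (4 * (1 + m ^ 2)) ^ (a/2) := Real.rpow_le_rpow (by positivity) h1 ha2
      _ = 4 ^ (a/2) * (1 + m ^ 2) ^ (a/2) := Real.mul_rpow (by norm_num) hm.le
      _ ≤ _ := by gcongr; exact le_add_of_nonneg_right (by positivity)
  · have h1 : 1 + (m + k) ^ 2 ≤ 4 * (1 + k ^ 2) := by nlinarith [sq_nonneg (m - k)]
    have h2 : (1 + k ^ 2) ^ (a/2) ≤
        (1 + k ^ 2) ^ (b/2) * ((1 + m ^ 2) ^ (a/2) * (1 + m ^ 2) ^ (-(b/2))) := by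
      rw [← Real.rpow_add hm]
      calc (1 + k ^ 2) ^ (a/2) = (1 + k ^ 2) ^ (b/2) * (1 + k ^ 2) ^ (a/2 + -(b/2)) := by
            rw [← Real.rpow_add hk]; congr 1; ring
        _ ≤ _ := by
          gcongr ?_ * ?_
          exact Real.rpow_le_rpow_of_nonpos hm h (by linarith)
    calc _ ≤ (4 * (1 + k ^ 2)) ^ (a/2) := Real.rpow_le_rpow (by positivity) h1 ha2
      _ = 4 ^ (a/2) * (1 + k ^ 2) ^ (a/2) := Real.mul_rpow (by norm_num) hk.le
      _ ≤ _ := by gcongr; exact h2.trans (le_add_of_nonneg_left (by positivity))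

lemma summable_weight (b : ℝ) (hb : 1 / 2 < b) :
    Summable (fun n : ℤ => (1 + (n:ℝ) ^ 2) ^ (-b)) := by
  have h := Real.summable_abs_int_rpow (b := 2 * b) (by linarith)
  refine Summable.of_norm_bounded_eventually h ?_
  rw [Filter.eventually_cofinite]
  refine (Set.finite_singleton (0:ℤ)).subset fun n hn => ?_
  by_contra h0
  apply hn
  have h0' : (n:ℝ) ≠ 0 := by exact_mod_cast h0
  have hp : 0 < |(n:ℝ)| := abs_pos.2 h0'
  rw [Real.norm_of_nonneg (by positivity)]
  calc (1 + (n:ℝ) ^ 2) ^ (-b) ≤ (|(n:ℝ)| ^ (2:ℝ)) ^ (-b) := by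
        refine Real.rpow_le_rpow_of_nonpos (by positivity) ?_ (by linarith)
        rw [Real.rpow_two, sq_abs]; linarith
    _ = _ := by rw [← Real.rpow_mul hp.le]; congr 1; ring

end SobAux

namespace SobAux

/-- the Sobolev weight -/
def wt (q : ℝ) (n : ℤ) : ℝ≥0∞ := ENNReal.ofReal ((1 + (n:ℝ) ^ 2) ^ (q/2))

/-- weighted coefficients -/
def wc (q : ℝ) (f : ℝ → ℝ) (n : ℤ) : ℝ≥0∞ := wt q n * ‖fCoeff f n‖ₑ

lemma wt_sq (q : ℝ) (n : ℤ) : wt q n ^ 2 = ENNReal.ofReal ((1 + (n:ℝ) ^ 2) ^ q) := by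
  have h : (0:ℝ) < 1 + (n:ℝ) ^ 2 := by positivity
  rw [wt, ← ENNReal.ofReal_pow (by positivity), ← Real.rpow_natCast, ← Real.rpow_mul h.le]
  congr 2; push_cast; ring

lemma wc_sq (q : ℝ) (f : ℝ → ℝ) (n : ℤ) :
    wc q f n ^ 2 = ENNReal.ofReal ((1 + (n:ℝ) ^ 2) ^ q * ‖fCoeff f n‖ ^ 2) := by
  rw [wc, mul_pow, wt_sq, ENNReal.ofReal_mul (by positivity), ENNReal.ofReal_pow (norm_nonneg _),
    ofReal_norm]

lemma sob_eq (q : ℝ) (f : ℝ → ℝ) : sobSq₁ q f = (∑' n, wc q f n ^ 2).toReal := by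
  simp only [wc_sq]
  rw [ENNReal.tsum_toReal_eq (fun _ => ENNReal.ofReal_ne_top), sobSq₁]
  congr 1; ext n
  rw [ENNReal.toReal_ofReal (by positivity)]

lemma sob_fin (q : ℝ) (f : ℝ → ℝ) (h : InH₁ q f) : ∑' n, wc q f n ^ 2 ≠ ⊤ := by
  simp only [wc_sq]
  exact h.2.2.tsum_ofReal_ne_top

lemma wt_inv (b : ℝ) (n : ℤ) : wt b n * wt (-b) n = 1 := by
  have h : (0:ℝ) < 1 + (n:ℝ) ^ 2 := by positivity
  rw [wt, wt, ← ENNReal.ofReal_mul (by positivity), ← Real.rpow_add h]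
  have : b / 2 + -b / 2 = 0 := by ring
  simp [this]

lemma wc_mul (b : ℝ) (g : ℝ → ℝ) (n : ℤ) : wc b g n * wt (-b) n = ‖fCoeff g n‖ₑ := by
  rw [wc, mul_right_comm, wt_inv, one_mul]

lemma wt_fin (b : ℝ) (hb : 1 / 2 < b) : ∑' n, wt (-b) n ^ 2 ≠ ⊤ := by
  simp only [wt_sq]
  exact (summable_weight b hb).tsum_ofReal_ne_top

lemma wt_key (a b : ℝ) (ha : 0 ≤ a) (hab : a ≤ b) (n k : ℤ) :
    wt a n ≤ ENNReal.ofReal (4 ^ (a/2)) *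
      (wt a (n - k) + wt b k * (wt a (n - k) * wt (-b) (n - k))) := by
  have h := key_real a b ha hab ((n - k : ℤ) : ℝ) (k : ℝ)
  have e : ((n - k : ℤ) : ℝ) + (k : ℝ) = n := by push_cast; ring
  rw [e] at h
  simp only [wt, neg_div]
  rw [← ENNReal.ofReal_mul (by positivity), ← ENNReal.ofReal_mul (by positivity),
    ← ENNReal.ofReal_add (by positivity) (by positivity), ← ENNReal.ofReal_mul (by positivity)]
  exact ENNReal.ofReal_le_ofReal h

lemma coeff_summable (b : ℝ) (hb : 1 / 2 < b) (g : ℝ → ℝ) (h : InH₁ b g) :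
    Summable (fun n => ‖fCoeff g n‖) := by
  have h1 := cs (wc b g) (wt (-b))
  simp only [wc_mul] at h1
  have h2 : (∑' k, ‖fCoeff g k‖ₑ) ^ 2 ≠ ⊤ :=
    ne_top_of_le_ne_top (ENNReal.mul_ne_top (sob_fin b g h) (wt_fin b hb)) h1
  have h3 : (∑' k, ‖fCoeff g k‖ₑ) ≠ ⊤ := by
    intro h4; simp [h4] at h2
  simpa using ENNReal.summable_toReal h3

lemma pointwise (a b : ℝ) (hb : 1 / 2 < b) (ha : 0 ≤ a) (hab : a ≤ b) (f g : ℝ → ℝ)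
    (hf : InH₁ a f) (hg : InH₁ b g) (n : ℤ) :
    wc a (fun θ => f θ * g θ) n ≤ ENNReal.ofReal (4 ^ (a/2)) *
      (∑' k, wc a f (n - k) * (wc b g k * wt (-b) k) +
        ∑' k, wc b g k * (wc a f (n - k) * wt (-b) (n - k))) := by
  have h1 := prod_coeff f g hf.2.1 hg.2.1 (coeff_summable b hb g hg) n
  rw [wc, ← h1.tsum_eq, ← ENNReal.tsum_add, ← ENNReal.tsum_mul_left]
  calc _ ≤ wt a n * ∑' k, ‖fCoeff g k * fCoeff f (n - k)‖ₑ := by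
        gcongr; exact enorm_tsum_le_tsum_enorm
    _ = ∑' k, wt a n * (‖fCoeff g k‖ₑ * ‖fCoeff f (n - k)‖ₑ) := by
        rw [← ENNReal.tsum_mul_left]; simp only [enorm_mul]
    _ ≤ _ := by
        refine ENNReal.tsum_le_tsum fun k => ?_
        rw [wc_mul]
        refine (mul_le_mul_left (wt_key a b ha hab n k) _).trans (le_of_eq ?_)
        simp only [wc]; ring

end SobAux


open SobAux

/-- module property: `‖f·g‖_{H^a} ≤ C ‖f‖_{H^a} ‖g‖_{H^b}` for
`b > 1/2`, `0 ≤ a ≤ b`. -/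
theorem sobolev_product_estimate (a b : ℝ) (hb : 1 / 2 < b) (ha : 0 ≤ a) (hab : a ≤ b) :
    ∃ C : ℝ, 0 < C ∧ ∀ f g : ℝ → ℝ, InH₁ a f → InH₁ b g →
      Real.sqrt (sobSq₁ a (fun θ => f θ * g θ)) ≤
        C * Real.sqrt (sobSq₁ a f) * Real.sqrt (sobSq₁ b g) := by
  have hS := wt_fin b hb
  have hS1 : 0 < (∑' n, wt (-b) n ^ 2).toReal := by
    refine ENNReal.toReal_pos ?_ hS
    intro h0
    have := (ENNReal.tsum_eq_zero.1 h0) 0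
    simp [wt] at this
  have hK : (0:ℝ) < 4 ^ (a/2) := by positivity
  refine ⟨Real.sqrt (4 * (4 ^ (a/2)) ^ 2 * (∑' n, wt (-b) n ^ 2).toReal),
    Real.sqrt_pos.2 (by positivity), fun f g hf hg => ?_⟩
  have h := total (wc a f) (wc b g) (wt (-b)) (wc a (fun θ => f θ * g θ)) _
    (pointwise a b hb ha hab f g hf hg)
  rw [← Real.sqrt_mul (by positivity), ← Real.sqrt_mul (by rw [sob_eq]; positivity)]
  apply Real.sqrt_le_sqrt
  rw [sob_eq, sob_eq, sob_eq]
  have hU := sob_fin a f hf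
  have hV := sob_fin b g hg
  have htop : 4 * ENNReal.ofReal (4 ^ (a/2)) ^ 2 * (∑' k, wt (-b) k ^ 2) *
      ((∑' k, wc a f k ^ 2) * ∑' k, wc b g k ^ 2) ≠ ⊤ := by
    refine ENNReal.mul_ne_top (ENNReal.mul_ne_top (ENNReal.mul_ne_top (by norm_num) ?_) hS)
      (ENNReal.mul_ne_top hU hV)
    exact ENNReal.pow_ne_top ENNReal.ofReal_ne_top
  refine (ENNReal.toReal_mono htop h).trans (le_of_eq ?_)
  simp only [ENNReal.toReal_mul, ENNReal.toReal_pow, ENNReal.toReal_ofReal hK.le]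
  norm_num
  ring

end
end

section
/- Let b > 1/2 and 0 ≤ a ≤ b. Then there is a constant C = C(a,b) > 0 such that for all f ∈ H^a(S¹,ℝ) and g ∈ H^b(S¹,ℝ) the pointwise product satisfies the homogeneous estimate ‖f·g‖_{Ḣ^a} ≤ C ( |f̂(0)| ‖g‖_{Ḣ^a} + |ĝ(0)| ‖f‖_{Ḣ^a} + ‖f‖_{Ḣ^a} ‖g‖_{Ḣ^b} ), where f̂(0), ĝ(0) are the zeroth Fourier coefficients (mean values) of f and g. -/
open MeasureTheory intervalIntegral
open scoped BigOperators ENNReal RealInnerProductSpace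

noncomputable section

/-- The `ℓ²` element built from a square-summable sequence, with its norm. -/
theorem hpe_toL2 (X : ℤ → ℝ) (hX : Summable fun n => X n ^ 2) :
    ∃ V : lp (fun _ : ℤ => ℝ) 2, (∀ n, V n = X n) ∧ ‖V‖ = Real.sqrt (∑' n, X n ^ 2) := by
  have hm : Memℓp X 2 := by
    apply memℓp_gen
    simpa using hX
  refine ⟨⟨X, hm⟩, fun n => rfl, ?_⟩
  rw [lp.norm_eq_tsum_rpow (by norm_num)]
  rw [Real.sqrt_eq_rpow]
  simp

theorem hpe_young (y X : ℤ → ℝ) (hy0 : ∀ n, 0 ≤ y n) (hy : Summable y)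
    (hX : Summable fun n => X n ^ 2) :
    ∃ V : lp (fun _ : ℤ => ℝ) 2, (∀ n, HasSum (fun m => y m * X (n - m)) (V n)) ∧
      ‖V‖ ≤ (∑' n, y n) * Real.sqrt (∑' n, X n ^ 2) := by
  have hT : ∀ m : ℤ, ∃ V : lp (fun _ : ℤ => ℝ) 2, (∀ n, V n = X (n - m)) ∧
      ‖V‖ = Real.sqrt (∑' n, X n ^ 2) := by
    intro m
    obtain ⟨V, h1, h2⟩ := hpe_toL2 (fun n => X (n - m))
      ((Equiv.subRight m).summable_iff (f := fun n => X n ^ 2) |>.2 hX)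
    refine ⟨V, h1, ?_⟩
    rw [h2]
    congr 1
    exact (Equiv.subRight m).tsum_eq (fun n => X n ^ 2)
  choose T hT1 hT2 using hT
  have hn : ∀ m, ‖y m • T m‖ = y m * Real.sqrt (∑' n, X n ^ 2) := by
    intro m
    rw [norm_smul, hT2, Real.norm_of_nonneg (hy0 m)]
  have hs : Summable fun m => ‖y m • T m‖ := by
    simp_rw [hn]
    exact hy.mul_right _
  refine ⟨∑' m, y m • T m, ?_, ?_⟩
  · intro n
    have := (hs.of_norm.hasSum).mapL (lp.evalCLM ℝ (fun _ : ℤ => ℝ) 2 n)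
    refine this.congr_fun fun m => ?_
    change y m * X (n - m) = (y m • T m : lp (fun _ : ℤ => ℝ) 2) n
    simp [hT1]
  · refine (norm_tsum_le_tsum_norm hs).trans ?_
    simp_rw [hn]
    rw [tsum_mul_right]

theorem hpe_cs (u v : ℤ → ℝ) (hu0 : ∀ n, 0 ≤ u n) (hv0 : ∀ n, 0 ≤ v n)
    (hu : Summable fun n => u n ^ 2) (hv : Summable fun n => v n ^ 2) :
    (Summable fun n => u n * v n) ∧
      ∑' n, u n * v n ≤ Real.sqrt (∑' n, u n ^ 2) * Real.sqrt (∑' n, v n ^ 2) := by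
  have := Real.summable_and_inner_le_Lp_mul_Lq_tsum_of_nonneg (p := 2) (q := 2)
    Real.HolderConjugate.two_two hu0 hv0 (by simpa using hu) (by simpa using hv)
  simpa [Real.sqrt_eq_rpow] using this

/-- The weight inequality. -/
theorem hpe_weight (a b : ℝ) (ha : 0 ≤ a) (hab : a ≤ b) (k m : ℤ)
    (x y : ℝ) (hx : 0 ≤ x) (hy : 0 ≤ y) :
    |((k + m : ℤ) : ℝ)| ^ a * (x * y) ≤ 2 ^ a * (y * (|(k : ℝ)| ^ a * x) +
      (if k = 0 then x * (|(m : ℝ)| ^ a * y) else 0) +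
      (|(k : ℝ)| ^ (-b) * (|(k : ℝ)| ^ a * x)) * (|(m : ℝ)| ^ b * y)) := by
  have h2 : (1 : ℝ) ≤ 2 ^ a := Real.one_le_rpow (by norm_num) ha
  have hxy : 0 ≤ x * y := mul_nonneg hx hy
  by_cases hk : k = 0
  · subst hk
    simp only [zero_add, if_true]
    have e1 : 0 ≤ y * (|((0 : ℤ) : ℝ)| ^ a * x) := by positivity
    have e2 : 0 ≤ (|((0 : ℤ) : ℝ)| ^ (-b) * (|((0 : ℤ) : ℝ)| ^ a * x)) * (|(m : ℝ)| ^ b * y) := by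
      positivity
    have e3 : 0 ≤ x * (|(m : ℝ)| ^ a * y) := by positivity
    nlinarith
  · simp only [hk, if_false, add_zero]
    have hk1 : (1 : ℝ) ≤ |(k : ℝ)| := by exact_mod_cast Int.one_le_abs hk
    have hk0 : (0 : ℝ) < |(k : ℝ)| := by linarith
    have htri : |((k + m : ℤ) : ℝ)| ≤ |(k : ℝ)| + |(m : ℝ)| := by
      push_cast; exact abs_add_le _ _
    have e1 : 0 ≤ y * (|(k : ℝ)| ^ a * x) := by positivity
    have e2 : 0 ≤ (|(k : ℝ)| ^ (-b) * (|(k : ℝ)| ^ a * x)) * (|(m : ℝ)| ^ b * y) := by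
      positivity
    rcases le_total |(m : ℝ)| |(k : ℝ)| with h | h
    · have : |((k + m : ℤ) : ℝ)| ^ a ≤ 2 ^ a * |(k : ℝ)| ^ a := by
        rw [← Real.mul_rpow (by norm_num) (abs_nonneg _)]
        exact Real.rpow_le_rpow (abs_nonneg _) (by linarith) ha
      calc _ ≤ 2 ^ a * |(k : ℝ)| ^ a * (x * y) := mul_le_mul_of_nonneg_right this hxy
        _ = 2 ^ a * (y * (|(k : ℝ)| ^ a * x)) := by ring
        _ ≤ _ := by gcongr; linarith
    · have hm0 : (0 : ℝ) < |(m : ℝ)| := by linarith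
      have h1 : |((k + m : ℤ) : ℝ)| ^ a ≤ 2 ^ a * |(m : ℝ)| ^ a := by
        rw [← Real.mul_rpow (by norm_num) (abs_nonneg _)]
        exact Real.rpow_le_rpow (abs_nonneg _) (by linarith) ha
      have h3 : |(m : ℝ)| ^ a ≤ |(k : ℝ)| ^ (-b) * |(k : ℝ)| ^ a * |(m : ℝ)| ^ b := by
        rw [← Real.rpow_add hk0]
        calc |(m : ℝ)| ^ a = |(m : ℝ)| ^ (-b + a) * |(m : ℝ)| ^ b := by
              rw [← Real.rpow_add hm0]; congr 1; ring
          _ ≤ _ := by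
            gcongr ?_ * _
            exact Real.rpow_le_rpow_of_nonpos hk0 h (by linarith)
      calc _ ≤ 2 ^ a * |(m : ℝ)| ^ a * (x * y) := mul_le_mul_of_nonneg_right h1 hxy
        _ ≤ 2 ^ a * (|(k : ℝ)| ^ (-b) * |(k : ℝ)| ^ a * |(m : ℝ)| ^ b) * (x * y) := by gcongr
        _ = 2 ^ a * ((|(k : ℝ)| ^ (-b) * (|(k : ℝ)| ^ a * x)) * (|(m : ℝ)| ^ b * y)) := by ring
        _ ≤ _ := by gcongr; linarith

/-- Square summability and the `ℓ¹` bounds. -/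
theorem hpe_c (b : ℝ) (hb : 1 / 2 < b) : Summable fun n : ℤ => (|(n : ℝ)| ^ (-b)) ^ 2 := by
  have : (fun n : ℤ => (|(n : ℝ)| ^ (-b)) ^ 2) = fun n : ℤ => |(n : ℝ)| ^ (-(2 * b)) := by
    ext n
    rw [← Real.rpow_mul_natCast (abs_nonneg _)]
    congr 1; push_cast; ring
  rw [this]
  exact Real.summable_abs_int_rpow (by linarith)

theorem hpe_seq (a b : ℝ) (hb : 1 / 2 < b) (ha : 0 ≤ a) (hab : a ≤ b) (x y z : ℤ → ℝ)
    (hx0 : ∀ n, 0 ≤ x n) (hy0 : ∀ n, 0 ≤ y n) (hz0 : ∀ n, 0 ≤ z n)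
    (hX : Summable fun n : ℤ => (|(n : ℝ)| ^ a * x n) ^ 2)
    (hW : Summable fun n : ℤ => (|(n : ℝ)| ^ a * y n) ^ 2)
    (hY : Summable fun n : ℤ => (|(n : ℝ)| ^ b * y n) ^ 2)
    (hz : Summable y → ∀ n, ∃ s, HasSum (fun m => x (n - m) * y m) s ∧ z n ≤ s) :
    Real.sqrt (∑' n : ℤ, (|(n : ℝ)| ^ a * z n) ^ 2) ≤
      2 ^ a * (1 + 2 * Real.sqrt (∑' n : ℤ, (|(n : ℝ)| ^ (-b)) ^ 2)) *
      (x 0 * Real.sqrt (∑' n : ℤ, (|(n : ℝ)| ^ a * y n) ^ 2) +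
       y 0 * Real.sqrt (∑' n : ℤ, (|(n : ℝ)| ^ a * x n) ^ 2) +
       Real.sqrt (∑' n : ℤ, (|(n : ℝ)| ^ a * x n) ^ 2) *
        Real.sqrt (∑' n : ℤ, (|(n : ℝ)| ^ b * y n) ^ 2)) := by
  set K := Real.sqrt (∑' n : ℤ, (|(n : ℝ)| ^ (-b)) ^ 2) with hK
  set NX := Real.sqrt (∑' n : ℤ, (|(n : ℝ)| ^ a * x n) ^ 2) with hNX
  set NW := Real.sqrt (∑' n : ℤ, (|(n : ℝ)| ^ a * y n) ^ 2) with hNW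
  set NY := Real.sqrt (∑' n : ℤ, (|(n : ℝ)| ^ b * y n) ^ 2) with hNY
  have hK0 : 0 ≤ K := Real.sqrt_nonneg _
  have hNX0 : 0 ≤ NX := Real.sqrt_nonneg _
  have hNW0 : 0 ≤ NW := Real.sqrt_nonneg _
  have hNY0 : 0 ≤ NY := Real.sqrt_nonneg _
  have hX0 : ∀ n : ℤ, 0 ≤ |(n : ℝ)| ^ a * x n := fun n =>
    mul_nonneg (Real.rpow_nonneg (abs_nonneg _) _) (hx0 n)
  have hY0 : ∀ n : ℤ, 0 ≤ |(n : ℝ)| ^ b * y n := fun n =>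
    mul_nonneg (Real.rpow_nonneg (abs_nonneg _) _) (hy0 n)
  have hc0 : ∀ n : ℤ, 0 ≤ |(n : ℝ)| ^ (-b) := fun n => Real.rpow_nonneg (abs_nonneg _) _
  obtain ⟨hcX, hcX'⟩ := hpe_cs _ _ hc0 hX0 (hpe_c b hb) hX
  obtain ⟨hcY, hcY'⟩ := hpe_cs _ _ hc0 hY0 (hpe_c b hb) hY
  have hyeq : y = fun n : ℤ => (if n = 0 then y 0 else 0) +
      |(n : ℝ)| ^ (-b) * (|(n : ℝ)| ^ b * y n) := by
    ext n
    by_cases hn : n = 0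
    · subst hn
      have : -b ≠ 0 := by linarith
      simp [Real.zero_rpow this]
    · have hk0 : (0 : ℝ) < |(n : ℝ)| := by positivity
      rw [← mul_assoc, ← Real.rpow_add hk0]
      simp [hn]
  have hd : HasSum (fun n : ℤ => if n = 0 then y 0 else 0) (y 0) := hasSum_ite_eq 0 (y 0)
  have hysum := hd.add hcY.hasSum
  rw [← hyeq] at hysum
  have hy : Summable y := hysum.summable
  have hyle : ∑' n, y n ≤ y 0 + K * NY := by
    rw [hysum.tsum_eq]; linarith
  obtain ⟨V1, hV1, hV1n⟩ := hpe_young y _ hy0 hy hX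
  obtain ⟨V2, hV2, hV2n⟩ := hpe_young (fun n : ℤ => |(n : ℝ)| ^ (-b) * (|(n : ℝ)| ^ a * x n)) _
    (fun n => mul_nonneg (hc0 n) (hX0 n)) hcX hY
  obtain ⟨V3, hV3, hV3n⟩ := hpe_toL2 _ hW
  have hV2' : ∀ n : ℤ, HasSum (fun m : ℤ => |((n - m : ℤ) : ℝ)| ^ (-b) *
      (|((n - m : ℤ) : ℝ)| ^ a * x (n - m)) * (|(m : ℝ)| ^ b * y m)) (V2 n) := by
    intro n
    have := (Equiv.subLeft n).hasSum_iff.2 (hV2 n)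
    refine this.congr_fun ?_
    intro m
    simp [Function.comp]
  have hpt : ∀ n : ℤ, |(n : ℝ)| ^ a * z n ≤
      ((2 : ℝ) ^ a • (V1 + x 0 • V3 + V2) : lp (fun _ : ℤ => ℝ) 2) n := by
    intro n
    obtain ⟨s, hs, hzs⟩ := hz hy n
    have h3 : HasSum (fun m : ℤ => if n - m = 0 then x (n - m) * (|(m : ℝ)| ^ a * y m) else 0)
        (x 0 * V3 n) := by
      have := hasSum_ite_eq n (x 0 * V3 n)
      refine this.congr_fun ?_
      intro m
      by_cases hm : m = n
      · subst hm; simp [hV3]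
      · have : n - m ≠ 0 := by omega
        simp [hm, this]
    have hR := (((hV1 n).add h3).add (hV2' n)).mul_left ((2 : ℝ) ^ a)
    have hL := hs.mul_left (|(n : ℝ)| ^ a)
    have := hasSum_le (fun m => ?_) hL hR
    · calc |(n : ℝ)| ^ a * z n ≤ |(n : ℝ)| ^ a * s :=
          mul_le_mul_of_nonneg_left hzs (Real.rpow_nonneg (abs_nonneg _) _)
        _ ≤ _ := this
        _ = _ := rfl
    · have := hpe_weight a b ha hab (n - m) m (x (n - m)) (y m) (hx0 _) (hy0 _)
      rwa [sub_add_cancel] at this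
  set V : lp (fun _ : ℤ => ℝ) 2 := (2 : ℝ) ^ a • (V1 + x 0 • V3 + V2) with hVdef
  have hVn : ‖V‖ ≤ 2 ^ a * ((y 0 + K * NY) * NX + x 0 * NW + (K * NX) * NY) := by
    rw [hVdef, norm_smul, Real.norm_of_nonneg (by positivity)]
    gcongr
    refine norm_add₃_le.trans ?_
    rw [norm_smul, Real.norm_of_nonneg (hx0 0), hV3n]
    gcongr
    · exact hV1n.trans (by gcongr)
    · exact hV2n.trans (by gcongr)
  have hsq : Real.sqrt (∑' n : ℤ, (|(n : ℝ)| ^ a * z n) ^ 2) ≤ ‖V‖ := by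
    apply Real.sqrt_le_iff.2 ⟨norm_nonneg _, ?_⟩
    apply Real.tsum_le_of_sum_le (fun n => sq_nonneg _)
    intro u
    have := lp.sum_rpow_le_norm_rpow (p := 2) (by norm_num) V u
    simp only [ENNReal.toReal_ofNat, Real.rpow_ofNat] at this
    refine le_trans (Finset.sum_le_sum fun n _ => ?_) this
    have h0 : 0 ≤ |(n : ℝ)| ^ a * z n := mul_nonneg (Real.rpow_nonneg (abs_nonneg _) _) (hz0 n)
    exact pow_le_pow_left₀ h0 ((hpt n).trans (le_abs_self _)) 2
  refine hsq.trans (hVn.trans ?_)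
  have h2a : (0 : ℝ) ≤ 2 ^ a := by positivity
  rw [mul_assoc ((2 : ℝ) ^ a)]
  refine mul_le_mul_of_nonneg_left ?_ h2a
  have e1 := mul_nonneg (hx0 0) hNW0
  have e2 := mul_nonneg (hy0 0) hNX0
  have e3 := mul_nonneg hNX0 hNY0
  nlinarith [mul_nonneg hK0 e1, mul_nonneg hK0 e2, mul_nonneg hK0 e3]

theorem hpe_unique (u : ℝ → ℂ) (hu : IntegrableOn u (Set.Ioc (0:ℝ) 1))
    (h : ∀ n : ℤ, ∫ x in Set.Ioc (0:ℝ) 1, fourier n (x : AddCircle (1:ℝ)) * u x = 0) :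
    ∀ᵐ x ∂(volume.restrict (Set.Ioc (0:ℝ) 1)), u x = 0 := by
  have : Fact ((0:ℝ) < 1) := ⟨one_pos⟩
  have hint : ∀ φ : C(AddCircle (1:ℝ), ℂ),
      IntegrableOn (fun x : ℝ => φ (x : AddCircle (1:ℝ)) * u x) (Set.Ioc (0:ℝ) 1) := by
    intro φ
    refine Integrable.bdd_mul (c := ‖φ‖) hu ?_ ?_
    · exact (φ.continuous.comp (AddCircle.continuous_mk' 1)).aestronglyMeasurable
    · exact Filter.Eventually.of_forall fun x => φ.norm_coe_le_norm _
  let Φ : C(AddCircle (1:ℝ), ℂ) →ₗ[ℂ] ℂ :=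
    { toFun := fun φ => ∫ x in Set.Ioc (0:ℝ) 1, φ (x : AddCircle (1:ℝ)) * u x
      map_add' := by
        intro φ ψ
        rw [← integral_add (hint φ) (hint ψ)]
        simp [add_mul]
      map_smul' := by
        intro c φ
        simp only [ContinuousMap.smul_apply, smul_eq_mul, RingHom.id_apply, mul_assoc]
        exact MeasureTheory.integral_const_mul _ _ }
  let Ψ : C(AddCircle (1:ℝ), ℂ) →L[ℂ] ℂ :=
    Φ.mkContinuous (∫ x in Set.Ioc (0:ℝ) 1, ‖u x‖) (by
      intro φ
      change ‖∫ x in Set.Ioc (0:ℝ) 1, φ (x : AddCircle (1:ℝ)) * u x‖ ≤ _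
      refine (MeasureTheory.norm_integral_le_integral_norm _).trans ?_
      rw [mul_comm, ← MeasureTheory.integral_const_mul]
      refine integral_mono (hint φ).norm (hu.norm.const_mul _) fun x => ?_
      simp only [norm_mul]
      gcongr
      exact φ.norm_coe_le_norm _)
  have hzero : ∀ φ, Ψ φ = 0 := by
    intro φ
    have h1 : Submodule.span ℂ (Set.range (@fourier 1)) ≤ LinearMap.ker (Ψ : _ →ₗ[ℂ] ℂ) := by
      rw [Submodule.span_le]
      rintro _ ⟨n, rfl⟩
      exact h n
    have h2 := Submodule.topologicalClosure_minimal _ h1 (ContinuousLinearMap.isClosed_ker Ψ)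
    rw [span_fourier_closure_eq_top] at h2
    exact h2 (Submodule.mem_top (x := φ))
  have key := isOpen_Ioo.ae_eq_zero_of_integral_contDiff_smul_eq_zero (U := Set.Ioo (0:ℝ) 1)
    (μ := volume) (f := u) (hu.mono_set Set.Ioo_subset_Ioc_self).locallyIntegrableOn ?_
  · rw [← restrict_Ioo_eq_restrict_Ioc, ae_restrict_iff' measurableSet_Ioo]
    exact key
  · intro g hg _ hsupp
    have hout : ∀ x, x ∉ Set.Ioo (0:ℝ) 1 → g x = 0 := fun x hx =>
      image_eq_zero_of_notMem_tsupport fun hx' => hx (hsupp hx')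
    let G : ℝ → ℂ := fun x => (g x : ℂ)
    have hG : Continuous (AddCircle.liftIoc (1:ℝ) 0 G) := by
      apply AddCircle.liftIoc_zero_continuous
      · simp [G, hout 0 (by simp), hout 1 (by simp)]
      · exact (Complex.continuous_ofReal.comp hg.continuous).continuousOn
    have := hzero ⟨_, hG⟩
    change ∫ x in Set.Ioc (0:ℝ) 1, AddCircle.liftIoc (1:ℝ) 0 G (x : AddCircle (1:ℝ)) * u x = 0
      at this
    rw [← this, ← setIntegral_eq_integral_of_forall_compl_eq_zero (s := Set.Ioc (0:ℝ) 1)]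
    · refine setIntegral_congr_fun measurableSet_Ioc fun x hx => ?_
      rw [AddCircle.liftIoc_coe_apply (by simpa using hx)]
      simp [G]
    · intro x hx
      rw [hout x fun hx' => hx (Set.Ioo_subset_Ioc_self hx'), zero_smul]

theorem hpe_fCoeff (f : ℝ → ℝ) (n : ℤ) :
    fCoeff f n = ∫ x in Set.Ioc (0:ℝ) 1, fourier (-n) (x : AddCircle (1:ℝ)) * (f x : ℂ) := by
  rw [fCoeff, integral_of_le zero_le_one]
  refine setIntegral_congr_fun measurableSet_Ioc fun x _ => ?_
  simp only [fourier_coe_apply]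
  congr 2
  push_cast
  ring

/-- Multiplying an integrable function by an absolutely convergent Fourier series. -/
theorem hpe_mul (c : ℤ → ℂ) (hc : Summable fun m => ‖c m‖) (v : ℝ → ℂ)
    (hv : IntegrableOn v (Set.Ioc (0:ℝ) 1)) :
    HasSum (fun m => c m * ∫ x in Set.Ioc (0:ℝ) 1, fourier m (x : AddCircle (1:ℝ)) * v x)
      (∫ x in Set.Ioc (0:ℝ) 1, (∑' m, c m * fourier m (x : AddCircle (1:ℝ))) * v x) := by
  have hF : ∀ m : ℤ, Continuous fun x : ℝ => (fourier m (x : AddCircle (1:ℝ)) : ℂ) := fun m =>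
    (fourier m).continuous.comp (AddCircle.continuous_mk' 1)
  have hn : ∀ (m : ℤ) (x : ℝ), ‖(fourier m (x : AddCircle (1:ℝ)) : ℂ)‖ = 1 := fun m x =>
    Circle.norm_coe _
  have := hasSum_integral_of_summable_integral_norm
    (μ := volume.restrict (Set.Ioc (0:ℝ) 1))
    (F := fun (m : ℤ) (x : ℝ) => c m * (fourier m (x : AddCircle (1:ℝ)) * v x)) ?_ ?_
  · simp only [MeasureTheory.integral_const_mul] at this
    simp only [← tsum_mul_right, mul_assoc]
    exact this
  · intro m
    refine Integrable.const_mul ?_ _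
    exact Integrable.bdd_mul (c := 1) hv (hF m).aestronglyMeasurable
      (Filter.Eventually.of_forall fun x => (hn m x).le)
  · simp only [norm_mul, hn, one_mul, MeasureTheory.integral_const_mul]
    exact hc.mul_right _

theorem hpe_orth (n m : ℤ) :
    ∫ x in Set.Ioc (0:ℝ) 1, fourier n (x : AddCircle (1:ℝ)) * fourier m (x : AddCircle (1:ℝ))
      = if m = -n then (1:ℂ) else 0 := by
  have : Fact ((0:ℝ) < 1) := ⟨one_pos⟩
  have h1 : fourierCoeff (T := 1) (fourier (n + m)) 0 =
     ∫ x in Set.Ioc (0:ℝ) 1, fourier n (x : AddCircle (1:ℝ)) * fourier m (x : AddCircle (1:ℝ)) := by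
    rw [fourierCoeff_eq_intervalIntegral _ _ 0, zero_add, integral_of_le zero_le_one]
    rw [div_one, one_smul]
    refine setIntegral_congr_fun measurableSet_Ioc fun x _ => ?_
    simp only [neg_zero, fourier_zero, one_smul, fourier_add]
  rw [← h1, fourierCoeff_fourier, Pi.single_apply]
  congr 1
  apply propext
  constructor <;> intro <;> omega

theorem hpe_conv (f g : ℝ → ℝ) (hf : IntegrableOn f (Set.Ioc (0:ℝ) 1))
    (hg : IntegrableOn g (Set.Ioc (0:ℝ) 1)) (hs : Summable fun m => ‖fCoeff g m‖) (n : ℤ) :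
    HasSum (fun m => fCoeff g m * fCoeff f (n - m)) (fCoeff (fun θ => f θ * g θ) n) := by
  set S : ℝ → ℂ := fun x => ∑' m, fCoeff g m * fourier m (x : AddCircle (1:ℝ)) with hS
  have hF : ∀ m : ℤ, Continuous fun x : ℝ => (fourier m (x : AddCircle (1:ℝ)) : ℂ) := fun m =>
    (fourier m).continuous.comp (AddCircle.continuous_mk' 1)
  have hn : ∀ (m : ℤ) (x : ℝ), ‖(fourier m (x : AddCircle (1:ℝ)) : ℂ)‖ = 1 := fun m x =>
    Circle.norm_coe _
  have hScont : Continuous S :=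
    continuous_tsum (fun m => continuous_const.mul (hF m)) hs (fun m x => by rw [norm_mul, hn, mul_one])
  have hSint : IntegrableOn S (Set.Ioc (0:ℝ) 1) :=
    (hScont.continuousOn.integrableOn_compact isCompact_Icc).mono_set Set.Ioc_subset_Icc_self
  have hFint : ∀ m : ℤ, IntegrableOn (fun x : ℝ => (fourier m (x : AddCircle (1:ℝ)) : ℂ))
      (Set.Ioc (0:ℝ) 1) := fun m =>
    ((hF m).continuousOn.integrableOn_compact isCompact_Icc).mono_set Set.Ioc_subset_Icc_self
  have hgC : IntegrableOn (fun x => (g x : ℂ)) (Set.Ioc (0:ℝ) 1) := hg.ofReal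
  have hfC : IntegrableOn (fun x => (f x : ℂ)) (Set.Ioc (0:ℝ) 1) := hf.ofReal
  have hmul : ∀ (m : ℤ) (v : ℝ → ℂ), IntegrableOn v (Set.Ioc (0:ℝ) 1) →
      IntegrableOn (fun x : ℝ => (fourier m (x : AddCircle (1:ℝ)) : ℂ) * v x)
        (Set.Ioc (0:ℝ) 1) := fun m v hv =>
    Integrable.bdd_mul (c := 1) hv (hF m).aestronglyMeasurable
      (Filter.Eventually.of_forall fun x => (hn m x).le)
  have hae : ∀ᵐ x ∂(volume.restrict (Set.Ioc (0:ℝ) 1)), (g x : ℂ) - S x = 0 := by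
    refine hpe_unique (fun x => (g x : ℂ) - S x) (hgC.sub hSint) fun k => ?_
    simp only [mul_sub]
    rw [integral_sub (hmul k _ hgC) (hmul k _ hSint), sub_eq_zero]
    have h1 := hpe_mul (fun m => fCoeff g m) hs
      (fun x => (fourier k (x : AddCircle (1:ℝ)) : ℂ)) (hFint k)
    simp only [hpe_orth] at h1
    have h2 : HasSum (fun m : ℤ => fCoeff g m * if k = -m then (1:ℂ) else 0) (fCoeff g (-k)) := by
      refine (hasSum_ite_eq (-k) (fCoeff g (-k))).congr_fun fun m => ?_
      by_cases hm : m = -k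
      · subst hm; simp
      · have : k ≠ -m := by omega
        simp [hm, this]
    have h3 := h2.unique h1
    rw [hpe_fCoeff, neg_neg] at h3
    rw [h3]
    congr 1
    ext x
    rw [mul_comm]
  have h1 := hpe_mul (fun m => fCoeff g m) hs
      (fun x => (fourier (-n) (x : AddCircle (1:ℝ)) : ℂ) * (f x : ℂ)) (hmul _ _ hfC)
  have e1 : fCoeff (fun θ => f θ * g θ) n = ∫ x in Set.Ioc (0:ℝ) 1,
      (∑' m, fCoeff g m * fourier m (x : AddCircle (1:ℝ))) *
        ((fourier (-n) (x : AddCircle (1:ℝ)) : ℂ) * (f x : ℂ)) := by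
    rw [hpe_fCoeff]
    apply MeasureTheory.integral_congr_ae
    filter_upwards [hae] with x hx
    have : (g x : ℂ) = S x := sub_eq_zero.1 hx
    push_cast
    rw [this]
    simp only [hS]
    ring
  rw [e1]
  refine h1.congr_fun fun m => ?_
  rw [hpe_fCoeff f]
  congr 2
  ext x
  rw [← mul_assoc, ← fourier_add]
  congr 3
  ring

theorem hpe_sqform (q : ℝ) (f : ℝ → ℝ) (n : ℤ) :
    (|(n : ℝ)| ^ q * ‖fCoeff f n‖) ^ 2 = |(n : ℝ)| ^ (2 * q) * ‖fCoeff f n‖ ^ 2 := by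
  rw [mul_pow, ← Real.rpow_mul_natCast (abs_nonneg _)]
  congr 2
  push_cast; ring

theorem hpe_summable (q r : ℝ) (hq : 0 ≤ q) (hqr : q ≤ r) (f : ℝ → ℝ) (hf : InH₁ r f) :
    Summable fun n : ℤ => (|(n : ℝ)| ^ q * ‖fCoeff f n‖) ^ 2 := by
  refine Summable.of_nonneg_of_le (fun n => sq_nonneg _) (fun n => ?_) hf.2.2
  rw [hpe_sqform]
  gcongr
  calc |(n : ℝ)| ^ (2 * q) = ((n : ℝ) ^ 2) ^ q := by
        rw [Real.rpow_mul (abs_nonneg _)]; norm_num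
    _ ≤ (1 + (n : ℝ) ^ 2) ^ q := Real.rpow_le_rpow (sq_nonneg _) (by linarith) hq
    _ ≤ _ := Real.rpow_le_rpow_of_exponent_le (by nlinarith [sq_nonneg (n : ℝ)]) hqr

/-- homogeneous product estimate:
`‖f·g‖_{Ḣ^a} ≤ C(|f̂(0)| ‖g‖_{Ḣ^a} + |ĝ(0)| ‖f‖_{Ḣ^a} + ‖f‖_{Ḣ^a} ‖g‖_{Ḣ^b})`
for `b > 1/2`, `0 ≤ a ≤ b`. -/
theorem homogeneous_product_estimate (a b : ℝ) (hb : 1 / 2 < b) (ha : 0 ≤ a)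
    (hab : a ≤ b) :
    ∃ C : ℝ, 0 < C ∧ ∀ f g : ℝ → ℝ, InH₁ a f → InH₁ b g →
      Real.sqrt (homSobSq₁ a (fun θ => f θ * g θ)) ≤
        C * (‖fCoeff f 0‖ * Real.sqrt (homSobSq₁ a g) +
          ‖fCoeff g 0‖ * Real.sqrt (homSobSq₁ a f) +
          Real.sqrt (homSobSq₁ a f) * Real.sqrt (homSobSq₁ b g)) := by
  refine ⟨2 ^ a * (1 + 2 * Real.sqrt (∑' n : ℤ, (|(n : ℝ)| ^ (-b)) ^ 2)), by positivity, ?_⟩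
  intro f g hf hg
  have h := hpe_seq a b hb ha hab (fun n => ‖fCoeff f n‖) (fun n => ‖fCoeff g n‖)
    (fun n => ‖fCoeff (fun θ => f θ * g θ) n‖) (fun n => norm_nonneg _) (fun n => norm_nonneg _)
    (fun n => norm_nonneg _) (hpe_summable a a ha le_rfl f hf) (hpe_summable a b ha hab g hg)
    (hpe_summable b b (ha.trans hab) le_rfl g hg) ?_
  · simpa only [hpe_sqform, homSobSq₁] using h
  · intro hs n
    have hc := hpe_conv f g hf.2.1 hg.2.1 hs n
    have hbd : ∀ k, ‖fCoeff f k‖ ≤ ∫ x in Set.Ioc (0:ℝ) 1, ‖f x‖ := by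
      intro k
      rw [hpe_fCoeff]
      refine (MeasureTheory.norm_integral_le_integral_norm _).trans (le_of_eq ?_)
      congr 1
      ext x
      rw [norm_mul, Complex.norm_real]
      have : ‖(fourier (-k) (x : AddCircle (1:ℝ)) : ℂ)‖ = 1 := Circle.norm_coe _
      rw [this, one_mul]
    have hsum : Summable fun m => ‖fCoeff g m * fCoeff f (n - m)‖ := by
      refine Summable.of_nonneg_of_le (fun m => norm_nonneg _) (fun m => ?_)
        (hs.mul_right (∫ x in Set.Ioc (0:ℝ) 1, ‖f x‖))
      rw [norm_mul]
      exact mul_le_mul_of_nonneg_left (hbd _) (norm_nonneg _)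
    refine ⟨∑' m, ‖fCoeff g m * fCoeff f (n - m)‖, ?_, ?_⟩
    · refine hsum.hasSum.congr_fun fun m => ?_
      rw [norm_mul, mul_comm]
    · rw [← hc.tsum_eq]
      exact norm_tsum_le_tsum_norm hsum

end
end
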